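/- Assume that for each simple graph T on ℕ a coding bijection φ_T : G_T → ℕ is given, with induced group operation ⋆_T on ℕ, in such a way that the map X_Gr → ℕ^(ℕ×ℕ), T ↦ ⋆_T, is Borel. Let B ⊆ X_Gr be a Borel set. If for every injective finite sequence s of natural numbers the set {T ∈ B : some graph automorphism of T extends s} is Borel, then for every injective finite sequence s of natural numbers the set {T ∈ B : some group automorphism of (ℕ, ⋆_T) extends s} is Borel. (Equivalently: if the map sending T ∈ B to Aut(T), viewed as a closed subgroup of S_∞ with the Effros Borel structure, is Borel, then so is the map sending T ∈ B to Aut(ℕ, ⋆_T).) -/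

import Mathlib

/-- The Polish space of simple graphs on `ℕ`, coded as symmetric irreflexive
`{0,1}`-valued functions on `ℕ × ℕ`. -/
abbrev XGr := { A : ℕ × ℕ → Bool // (∀ a b, A (a, b) = A (b, a)) ∧ ∀ a, A (a, a) = false }

/-- The relators of Williams' group `G_T` associated to a graph with adjacency relation
`Adj`: the relators are `v_i^7`, `(v_i v_j)^11` for adjacent `i, j`, and `(v_i v_j)^13`
for distinct non-adjacent `i, j`. -/
def grRels (Adj : ℕ → ℕ → Prop) : Set (FreeGroup ℕ) :=
  {r | (∃ i, r = FreeGroup.of i ^ 7) ∨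
    (∃ i j, Adj i j ∧ r = (FreeGroup.of i * FreeGroup.of j) ^ 11) ∨
    (∃ i j, i ≠ j ∧ ¬ Adj i j ∧ r = (FreeGroup.of i * FreeGroup.of j) ^ 13)}

/-- Williams' group `G_T`, presented by the generators `v_i` and the relators above. -/
abbrev GT (Adj : ℕ → ℕ → Prop) : Type := PresentedGroup (grRels Adj)

/-- The generator `v_i` of `G_T`. -/
def gen (Adj : ℕ → ℕ → Prop) (i : ℕ) : GT Adj := PresentedGroup.of i

/-- A coding bijection for `G_T`: a bijection `φ : G_T → ℕ` together with an assignment to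
each element of `G_T` of a reduced word (i.e. a free group element) representing it, such
that `φ(1) = 0`, `φ(v_i) = 3i+1`, `φ(v_i⁻¹) = 3i+2`, the obvious words are assigned to
`1`, `v_i`, `v_i⁻¹`, and every proper subword of the word assigned to `φ⁻¹(n)` represents
an element with `φ`-value strictly less than `n`. -/
structure CodingBijection (Adj : ℕ → ℕ → Prop) where
  toEquiv : GT Adj ≃ ℕ
  word : GT Adj → FreeGroup ℕ
  word_mk : ∀ g, (QuotientGroup.mk (word g) : GT Adj) = g
  word_one : word 1 = 1
  word_gen : ∀ i, word (gen Adj i) = FreeGroup.of i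
  word_gen_inv : ∀ i, word (gen Adj i)⁻¹ = (FreeGroup.of i)⁻¹
  map_one : toEquiv 1 = 0
  map_gen : ∀ i, toEquiv (gen Adj i) = 3 * i + 1
  map_gen_inv : ∀ i, toEquiv (gen Adj i)⁻¹ = 3 * i + 2
  subword_lt : ∀ (n : ℕ) (u : FreeGroup ℕ),
    u.toWord <:+: (word (toEquiv.symm n)).toWord →
    u.toWord ≠ (word (toEquiv.symm n)).toWord →
    toEquiv (QuotientGroup.mk u : GT Adj) < n

/-- The group operation on `ℕ` induced by a coding bijection:
`n ⋆ m = φ(φ⁻¹(n) · φ⁻¹(m))`. -/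
def CodingBijection.star {Adj : ℕ → ℕ → Prop} (c : CodingBijection Adj) (n m : ℕ) : ℕ :=
  c.toEquiv (c.toEquiv.symm n * c.toEquiv.symm m)

namespace WG

/-- Vertices of the free polygonal development. -/
inductive V : Type
  | base : V
  | o : V → ℕ → V
  | n : V → ℕ → V
  | p : V → ℕ → ℕ → ℕ → V

open V

def lab (d e t : ℕ) : ℕ := if t % 2 = 0 then e else d

theorem lab_add_two (d e t : ℕ) : lab d e (t + 2) = lab d e t := by
  simp [lab]

theorem lab_self (d t : ℕ) : lab d d t = d := by simp [lab]

theorem lab_zero (d e : ℕ) : lab d e 0 = e := by simp [lab]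
theorem lab_one (d e : ℕ) : lab d e 1 = d := by simp [lab]

/-- Edges present at birth: (outgoing, incoming). -/
def io (N : ℕ → ℕ → ℕ) : V → (ℕ → Option V) × (ℕ → Option V)
  | base => (fun _ => none, fun _ => none)
  | o u d => (fun e => some (p u d e 0), fun a => if a = d then some u else none)
  | n x c => (fun b => if b = c then some x else none,
      fun b => match (io N x).1 b with
        | none => some (p x b c (N b c - 4))
        | some u => some (p u c b (N c b - 5)))
  | p u d e t => (fun b => if b = lab d e (t + 1) then
        (match (io N u).2 e with
          | none => if t + 1 < N d e - 3 then some (p u d e (t + 1)) else some (n u e)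
          | some x => if t + 1 < N d e - 4 then some (p u d e (t + 1)) else some (n x d))
        else none,
      fun a => if a = lab d e t then
        (match t with
          | 0 => some (o u d)
          | t + 1 => some (p u d e t)) else none)

abbrev outB (N : ℕ → ℕ → ℕ) (v : V) (b : ℕ) : Option V := (io N v).1 b
abbrev inB (N : ℕ → ℕ → ℕ) (v : V) (b : ℕ) : Option V := (io N v).2 b

/-- number of interior points of a polygon -/
def K (N : ℕ → ℕ → ℕ) (u : V) (d e : ℕ) : ℕ :=
  match inB N u e with
  | none => N d e - 3
  | some _ => N d e - 4

def valid (N : ℕ → ℕ → ℕ) : V → Prop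
  | base => True
  | o u d => valid N u ∧ outB N u d = none
  | n u c => valid N u ∧ inB N u c = none
  | p u d e t => valid N u ∧ outB N u d = none ∧ t < K N u d e

structure NOK (N : ℕ → ℕ → ℕ) : Prop where
  symm : ∀ a b, N a b = N b a
  ge : ∀ a b, 7 ≤ N a b
  even : ∀ a b, a ≠ b → N a b % 2 = 0

variable {N : ℕ → ℕ → ℕ}

theorem lab_even (hN : NOK N) (d e k : ℕ) (hk : k % 2 = 0) (h : k ≤ N d e) :
    lab d e (N d e - k) = e := by
  by_cases hde : d = e
  · subst hde; simp [lab]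
  · have := hN.even d e hde
    unfold lab; rw [if_pos (by omega)]

theorem lab_odd (hN : NOK N) (d e k : ℕ) (hk : k % 2 = 1) (h : k ≤ N d e) :
    lab d e (N d e - k) = d := by
  by_cases hde : d = e
  · subst hde; simp [lab]
  · have := hN.even d e hde
    unfold lab; rw [if_neg (by omega)]

theorem K_pos (hN : NOK N) (u : V) (d e : ℕ) : 3 ≤ K N u d e := by
  have := hN.ge d e
  unfold K; split <;> omega

theorem K_le (N : ℕ → ℕ → ℕ) (u : V) (d e : ℕ) : K N u d e ≤ N d e - 3 := by
  unfold K; split <;> omega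

theorem K_ge (N : ℕ → ℕ → ℕ) (u : V) (d e : ℕ) : N d e - 4 ≤ K N u d e := by
  unfold K; split <;> omega

theorem K_none {u : V} {e : ℕ} (d : ℕ) (h : inB N u e = none) : K N u d e = N d e - 3 := by
  unfold K; rw [h]

theorem K_some {u x : V} {e : ℕ} (d : ℕ) (h : inB N u e = some x) : K N u d e = N d e - 4 := by
  unfold K; rw [h]

theorem out_base (b : ℕ) : outB N base b = none := rfl
theorem in_base (b : ℕ) : inB N base b = none := rfl
theorem out_o (u : V) (d e : ℕ) : outB N (o u d) e = some (p u d e 0) := rfl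
theorem in_o (u : V) (d a : ℕ) : inB N (o u d) a = if a = d then some u else none := rfl
theorem out_n (x : V) (c b : ℕ) : outB N (n x c) b = if b = c then some x else none := rfl
theorem in_n_none {x : V} {b : ℕ} (c : ℕ) (h : outB N x b = none) :
    inB N (n x c) b = some (p x b c (N b c - 4)) := by
  simp only [inB, io]; unfold outB at h; rw [h]
theorem in_n_some {x u : V} {b : ℕ} (c : ℕ) (h : outB N x b = some u) :
    inB N (n x c) b = some (p u c b (N c b - 5)) := by
  simp only [inB, io]; unfold outB at h; rw [h]
theorem out_p_ne (u : V) (d e t b : ℕ) (h : b ≠ lab d e (t + 1)) :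
    outB N (p u d e t) b = none := by
  simp [outB, io, h]
theorem out_p_lt (u : V) (d e t : ℕ) (h : t + 1 < K N u d e) :
    outB N (p u d e t) (lab d e (t + 1)) = some (p u d e (t + 1)) := by
  simp only [outB, io, if_true]
  unfold K at h
  unfold inB at h
  cases hh : (io N u).2 e with
  | none => rw [hh] at h; simp only at h ⊢; rw [if_pos h]
  | some x => rw [hh] at h; simp only at h ⊢; rw [if_pos h]
theorem out_p_none (u : V) (d e t : ℕ) (h : t + 1 = K N u d e) (h2 : inB N u e = none) :
    outB N (p u d e t) (lab d e (t + 1)) = some (n u e) := by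
  rw [K_none d h2] at h
  simp only [outB, io, if_true]
  unfold inB at h2
  rw [h2]; simp only; rw [if_neg (by omega)]
theorem out_p_some (u x : V) (d e t : ℕ) (h : t + 1 = K N u d e) (h2 : inB N u e = some x) :
    outB N (p u d e t) (lab d e (t + 1)) = some (n x d) := by
  rw [K_some d h2] at h
  simp only [outB, io, if_true]
  unfold inB at h2
  rw [h2]; simp only; rw [if_neg (by omega)]
theorem in_p_ne (u : V) (d e t a : ℕ) (h : a ≠ lab d e t) :
    inB N (p u d e t) a = none := by
  simp [inB, io, h]
theorem in_p_zero (u : V) (d e : ℕ) :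
    inB N (p u d e 0) e = some (o u d) := by
  simp [inB, io, lab]
theorem in_p_succ (u : V) (d e t : ℕ) :
    inB N (p u d e (t + 1)) (lab d e (t + 1)) = some (p u d e t) := by
  simp [inB, io]

theorem out_p_none_iff {u : V} {d e t b : ℕ} :
    outB N (p u d e t) b = none ↔ b ≠ lab d e (t + 1) := by
  constructor
  · rintro h rfl
    simp only [outB, io, if_true] at h
    split at h <;> split_ifs at h
  · exact out_p_ne u d e t b

theorem in_p_none_iff {u : V} {d e t b : ℕ} :
    inB N (p u d e t) b = none ↔ b ≠ lab d e t := by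
  constructor
  · rintro h rfl
    cases t with
    | zero => rw [lab_zero, in_p_zero] at h; cases h
    | succ t => rw [in_p_succ] at h; cases h
  · exact in_p_ne u d e t b

theorem in_n_ne_none (x : V) (c b : ℕ) : inB N (n x c) b ≠ none := by
  cases h : outB N x b with
  | none => rw [in_n_none c h]; simp
  | some u => rw [in_n_some c h]; simp

theorem key (hN : NOK N) (u : V) : valid N u →
    (∀ e x d, inB N u e = some x → outB N u d = none →
      valid N x ∧ outB N x e = some u ∧ inB N x d = none) ∧
    (∀ b w c, outB N u b = some w → inB N u c = none →
      valid N w ∧ inB N w b = some u ∧ outB N w c = none) := by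
  induction u with
  | base => intro _; exact ⟨(fun e x d h => by cases h), (fun e x d h => by cases h)⟩
  | o u d ih =>
    intro hv
    refine ⟨fun e x d' _ h => by simp [out_o] at h, ?_⟩
    intro b w c hw hc
    rw [out_o] at hw
    obtain rfl := (Option.some.inj hw).symm
    have hcd : c ≠ d := by
      rintro rfl; simp [in_o] at hc
    refine ⟨⟨hv.1, hv.2, by have := K_pos hN u d b; omega⟩, in_p_zero u d b, ?_⟩
    exact out_p_ne _ _ _ _ _ (by rw [lab_one]; exact hcd)
  | n x c ih =>
    intro hv
    obtain ⟨hv, hc⟩ := hv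
    refine ⟨?_, fun b w c' _ h => absurd h (in_n_ne_none _ _ _)⟩
    intro e w d hw hd
    have hdc : d ≠ c := by
      rintro rfl; simp [out_n] at hd
    cases h : outB N x e with
    | none =>
      rw [in_n_none c h] at hw
      obtain rfl := (Option.some.inj hw).symm
      have h7 := hN.ge e c
      have hK := K_none e hc
      refine ⟨⟨hv, h, by omega⟩, ?_, ?_⟩
      · have h1 := out_p_none x e c (N e c - 4) (by omega) hc
        rwa [show N e c - 4 + 1 = N e c - 3 by omega, lab_odd hN e c 3 rfl (by omega)] at h1
      · apply in_p_ne
        rw [lab_even hN e c 4 rfl (by omega)]; exact hdc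
    | some u' =>
      rw [in_n_some c h] at hw
      obtain rfl := (Option.some.inj hw).symm
      have h7 := hN.ge c e
      obtain ⟨h1, h2, h3⟩ := (ih hv).2 e u' c h hc
      have hK := K_some c h2
      refine ⟨⟨h1, h3, by omega⟩, ?_, ?_⟩
      · have h1 := out_p_some u' x c e (N c e - 5) (by omega) h2
        rwa [show N c e - 5 + 1 = N c e - 4 by omega, lab_even hN c e 4 rfl (by omega)] at h1
      · apply in_p_ne
        rw [lab_odd hN c e 5 rfl (by omega)]; exact hdc
  | p u d e t ih =>
    intro hv
    obtain ⟨hv, hd, ht⟩ := hv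
    have h7 := hN.ge d e
    constructor
    · intro a x d' hx hd'
      rw [out_p_none_iff] at hd'
      have ha : a = lab d e t := by
        by_contra h
        rw [in_p_ne _ _ _ _ _ h] at hx; simp at hx
      subst ha
      cases t with
      | zero =>
        rw [lab_zero, in_p_zero] at hx
        obtain rfl := (Option.some.inj hx).symm
        refine ⟨⟨hv, hd⟩, ?_, ?_⟩
        · rw [out_o, lab_zero]
        · rw [in_o, if_neg]; rwa [lab_one] at hd'
      | succ t =>
        rw [in_p_succ] at hx
        obtain rfl := (Option.some.inj hx).symm
        refine ⟨⟨hv, hd, by omega⟩, out_p_lt _ _ _ _ ht, ?_⟩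
        apply in_p_ne
        rwa [lab_add_two] at hd'
    · intro b w c hw hc
      rw [in_p_none_iff] at hc
      have hb : b = lab d e (t + 1) := by
        by_contra h
        rw [out_p_ne _ _ _ _ _ h] at hw; simp at hw
      subst hb
      rcases Nat.lt_or_ge (t + 1) (K N u d e) with hlt | hge
      · rw [out_p_lt _ _ _ _ hlt] at hw
        obtain rfl := (Option.some.inj hw).symm
        refine ⟨⟨hv, hd, hlt⟩, in_p_succ _ _ _ _, ?_⟩
        apply out_p_ne; rwa [lab_add_two]
      · have hE : t + 1 = K N u d e := by omega
        cases h : inB N u e with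
        | none =>
          rw [out_p_none _ _ _ _ hE h] at hw
          obtain rfl := (Option.some.inj hw).symm
          rw [K_none d h] at hE
          obtain rfl : t = N d e - 4 := by omega
          rw [hE, lab_odd hN d e 3 rfl (by omega)]
          rw [lab_even hN d e 4 rfl (by omega)] at hc
          refine ⟨⟨hv, h⟩, in_n_none e hd, ?_⟩
          rw [out_n, if_neg hc]
        | some x =>
          rw [out_p_some _ _ _ _ _ hE h] at hw
          obtain rfl := (Option.some.inj hw).symm
          rw [K_some d h] at hE
          obtain rfl : t = N d e - 5 := by omega
          rw [hE, lab_even hN d e 4 rfl (by omega)]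
          rw [lab_odd hN d e 5 rfl (by omega)] at hc
          obtain ⟨h1, h2, h3⟩ := (ih hv).1 e x d h hd
          refine ⟨⟨h1, h3⟩, in_n_some d h2, ?_⟩
          rw [out_n, if_neg hc]

def fF (N : ℕ → ℕ → ℕ) (b : ℕ) (v : V) : V := (outB N v b).getD (o v b)
def gF (N : ℕ → ℕ → ℕ) (a : ℕ) (v : V) : V := (inB N v a).getD (n v a)

theorem fF_none {v : V} {b : ℕ} (h : outB N v b = none) : fF N b v = o v b := by
  unfold fF; rw [h]; rfl
theorem fF_some {v w : V} {b : ℕ} (h : outB N v b = some w) : fF N b v = w := by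
  unfold fF; rw [h]; rfl
theorem gF_none {v : V} {b : ℕ} (h : inB N v b = none) : gF N b v = n v b := by
  unfold gF; rw [h]; rfl
theorem gF_some {v w : V} {b : ℕ} (h : inB N v b = some w) : gF N b v = w := by
  unfold gF; rw [h]; rfl

theorem f_main (hN : NOK N) (v : V) (hv : valid N v) (b : ℕ) :
    valid N (fF N b v) ∧ gF N b (fF N b v) = v := by
  cases h : outB N v b with
  | none =>
    rw [fF_none h]
    refine ⟨⟨hv, h⟩, gF_some ?_⟩
    simp [in_o]
  | some w =>
    rw [fF_some h]
    by_cases hc : ∃ c, inB N v c = none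
    · obtain ⟨c, hc⟩ := hc
      obtain ⟨h1, h2, -⟩ := (key hN v hv).2 b w c h hc
      exact ⟨h1, gF_some h2⟩
    · cases v with
      | base => exact absurd ⟨0, rfl⟩ hc
      | o u d => exact absurd ⟨d + 1, by simp [in_o]⟩ hc
      | n x c =>
        rw [out_n] at h
        split_ifs at h with hbc
        subst hbc
        obtain rfl := (Option.some.inj h).symm
        exact ⟨hv.1, gF_none hv.2⟩
      | p u d e t => exact absurd ⟨lab d e t + 1, in_p_ne _ _ _ _ _ (by omega)⟩ hc

theorem g_main (hN : NOK N) (v : V) (hv : valid N v) (b : ℕ) :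
    valid N (gF N b v) ∧ fF N b (gF N b v) = v := by
  cases h : inB N v b with
  | none =>
    rw [gF_none h]
    refine ⟨⟨hv, h⟩, fF_some ?_⟩
    simp [out_n]
  | some w =>
    rw [gF_some h]
    by_cases hc : ∃ c, outB N v c = none
    · obtain ⟨c, hc⟩ := hc
      obtain ⟨h1, h2, -⟩ := (key hN v hv).1 b w c h hc
      exact ⟨h1, fF_some h2⟩
    · cases v with
      | base => exact absurd ⟨0, rfl⟩ hc
      | n u d => exact absurd ⟨d + 1, by simp [out_n]⟩ hc
      | o x c =>
        rw [in_o] at h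
        split_ifs at h with hbc
        subst hbc
        obtain rfl := (Option.some.inj h).symm
        exact ⟨hv.1, fF_none hv.2⟩
      | p u d e t => exact absurd ⟨lab d e (t + 1) + 1, out_p_ne _ _ _ _ _ (by omega)⟩ hc

/-- The vertex set of the development. -/
abbrev X (N : ℕ → ℕ → ℕ) : Type := {v : V // valid N v}

def P (hN : NOK N) (b : ℕ) : Equiv.Perm (X N) where
  toFun v := ⟨fF N b v.1, (f_main hN v.1 v.2 b).1⟩
  invFun v := ⟨gF N b v.1, (g_main hN v.1 v.2 b).1⟩
  left_inv v := Subtype.ext (f_main hN v.1 v.2 b).2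
  right_inv v := Subtype.ext (g_main hN v.1 v.2 b).2

/-- step on states -/
def stp (hN : NOK N) : Equiv.Perm (X N × ℕ × ℕ) where
  toFun s := (P hN s.2.2 s.1, s.2.2, s.2.1)
  invFun s := ((P hN s.2.1).symm s.1, s.2.2, s.2.1)
  left_inv s := by simp
  right_inv s := by simp

theorem stp_run (hN : NOK N) (u : X N) (d e : ℕ) (hd : outB N u.1 d = none) (t : ℕ) :
    ∀ ht : t < K N u.1 d e,
    (stp hN ^ (t + 1)) (⟨o u.1 d, u.2, hd⟩, d, e) =
      (⟨p u.1 d e t, u.2, hd, ht⟩, lab d e t, lab d e (t + 1)) := by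
  induction t with
  | zero =>
    intro ht
    simp only [zero_add, pow_one, lab_zero, lab_one]
    rfl
  | succ t ih =>
    intro ht
    rw [pow_succ', Equiv.Perm.mul_apply, ih (by omega)]
    refine Prod.ext (Subtype.ext ?_) (Prod.ext ?_ ?_)
    · exact fF_some (out_p_lt _ _ _ _ ht)
    · rfl
    · exact (lab_add_two _ _ _).symm

theorem stp_val (hN : NOK N) (v : X N) (a b : ℕ) (w : X N) (h : fF N b v.1 = w.1) :
    stp hN (v, a, b) = (w, b, a) :=
  Prod.ext (Subtype.ext h) rfl

theorem stp_o (hN : NOK N) (u : X N) (d e : ℕ) (hd : outB N u.1 d = none) :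
    (stp hN ^ (N d e)) (⟨o u.1 d, u.2, hd⟩, d, e) = (⟨o u.1 d, u.2, hd⟩, d, e) := by
  have h7 := hN.ge d e
  have hKp := K_pos hN u.1 d e
  have hr := stp_run hN u d e hd (K N u.1 d e - 1) (by omega)
  have hk1 : K N u.1 d e - 1 + 1 = K N u.1 d e := by omega
  rw [hk1] at hr
  cases h : inB N u.1 e with
  | none =>
    have hK := K_none d h
    have e1 : N d e = 1 + (1 + (1 + K N u.1 d e)) := by omega
    rw [e1, pow_add, pow_add, pow_add, Equiv.Perm.mul_apply, Equiv.Perm.mul_apply,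
      Equiv.Perm.mul_apply, hr, pow_one]
    have hl : lab d e (K N u.1 d e) = d := by rw [hK]; exact lab_odd hN d e 3 rfl (by omega)
    have hl2 : lab d e (K N u.1 d e - 1) = e := by
      rw [hK, Nat.sub_sub]; exact lab_even hN d e 4 rfl (by omega)
    have ho := out_p_none u.1 d e (K N u.1 d e - 1) hk1 h
    rw [hk1] at ho
    rw [hl] at ho ⊢
    rw [hl2]
    have s1 := fun q => stp_val hN ⟨p u.1 d e (K N u.1 d e - 1), q⟩ e d ⟨n u.1 e, u.2, h⟩
      (fF_some ho)
    have s2 := stp_val hN ⟨n u.1 e, u.2, h⟩ d e u (fF_some (by simp [out_n]))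
    have s3 := stp_val hN u e d ⟨o u.1 d, u.2, hd⟩ (fF_none hd)
    exact (congrArg (fun s => stp hN (stp hN s)) (s1 _)).trans ((congrArg (stp hN) s2).trans s3)
  | some x =>
    have hK := K_some d h
    have e1 : N d e = 1 + (1 + (1 + (1 + K N u.1 d e))) := by omega
    obtain ⟨h1, h2, h3⟩ := (key hN u.1 u.2).1 e x d h hd
    rw [e1, pow_add, pow_add, pow_add, pow_add, Equiv.Perm.mul_apply, Equiv.Perm.mul_apply,
      Equiv.Perm.mul_apply, Equiv.Perm.mul_apply, hr, pow_one]
    have hl : lab d e (K N u.1 d e) = e := by rw [hK]; exact lab_even hN d e 4 rfl (by omega)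
    have hl2 : lab d e (K N u.1 d e - 1) = d := by
      rw [hK, Nat.sub_sub]; exact lab_odd hN d e 5 rfl (by omega)
    have ho := out_p_some u.1 x d e (K N u.1 d e - 1) hk1 h
    rw [hk1] at ho
    rw [hl] at ho ⊢
    rw [hl2]
    have s1 := fun q => stp_val hN ⟨p u.1 d e (K N u.1 d e - 1), q⟩ d e ⟨n x d, h1, h3⟩
      (fF_some ho)
    have s2 := stp_val hN ⟨n x d, h1, h3⟩ e d ⟨x, h1⟩ (fF_some (by simp [out_n]))
    have s3 := stp_val hN ⟨x, h1⟩ d e u (fF_some h2)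
    have s4 := stp_val hN u e d ⟨o u.1 d, u.2, hd⟩ (fF_none hd)
    exact (congrArg (fun s => stp hN (stp hN (stp hN s))) (s1 _)).trans
      ((congrArg (fun s => stp hN (stp hN s)) s2).trans ((congrArg (stp hN) s3).trans s4))

theorem fix_of_fix {α : Type*} (σ : Equiv.Perm α) (s : α) (k m : ℕ)
    (h : (σ ^ m) ((σ ^ k) s) = (σ ^ k) s) : (σ ^ m) s = s := by
  rw [← Equiv.Perm.mul_apply, (Commute.pow_pow_self σ m k).eq, Equiv.Perm.mul_apply] at h
  exact (σ ^ k).injective h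

theorem stp_fix (hN : NOK N) (v : X N) (a b : ℕ) :
    (stp hN ^ (N a b)) (v, a, b) = (v, a, b) := by
  cases hb : outB N v.1 b with
  | none =>
    apply fix_of_fix _ _ 1
    rw [pow_one, stp_val hN v a b ⟨o v.1 b, v.2, hb⟩ (fF_none hb), hN.symm a b]
    exact stp_o hN v b a hb
  | some w =>
    cases ha : inB N v.1 a with
    | none =>
      obtain ⟨h1, h2, h3⟩ := (key hN v.1 v.2).2 b w a hb ha
      apply fix_of_fix _ _ 2
      rw [pow_two, Equiv.Perm.mul_apply, stp_val hN v a b ⟨w, h1⟩ (fF_some hb),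
        stp_val hN ⟨w, h1⟩ b a ⟨o w a, h1, h3⟩ (fF_none h3)]
      exact stp_o hN ⟨w, h1⟩ a b h3
    | some y =>
      obtain ⟨v, hv⟩ := v
      cases v with
      | base => simp [out_base] at hb
      | o u d =>
        simp only [in_o] at ha
        split_ifs at ha with had
        subst had
        exact stp_o hN ⟨u, hv.1⟩ a b hv.2
      | n x c =>
        simp only [out_n] at hb
        split_ifs at hb with hbc
        subst hbc
        apply fix_of_fix _ _ 1
        rw [pow_one, stp_val hN _ a b ⟨x, hv.1⟩ (fF_some (by simp [out_n]))]
        cases h : outB N x a with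
        | none =>
          apply fix_of_fix _ _ 1
          rw [pow_one, stp_val hN _ b a ⟨o x a, hv.1, h⟩ (fF_none h)]
          exact stp_o hN ⟨x, hv.1⟩ a b h
        | some u =>
          obtain ⟨h1, h2, h3⟩ := (key hN x hv.1).2 a u b h hv.2
          apply fix_of_fix _ _ 2
          rw [pow_two, Equiv.Perm.mul_apply, stp_val hN _ b a ⟨u, h1⟩ (fF_some h),
            stp_val hN ⟨u, h1⟩ a b ⟨o u b, h1, h3⟩ (fF_none h3), hN.symm a b]
          exact stp_o hN ⟨u, h1⟩ b a h3
      | p u d e t =>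
        have hb' : b = lab d e (t + 1) := by
          by_contra h
          rw [out_p_ne _ _ _ _ _ h] at hb; simp at hb
        have ha' : a = lab d e t := by
          by_contra h
          rw [in_p_ne _ _ _ _ _ h] at ha; simp at ha
        have hNab : N a b = N d e := by
          rw [hb', ha']; unfold lab
          split_ifs <;> first | omega | exact hN.symm _ _
        rw [hNab, ha', hb', ← stp_run hN ⟨u, hv.1⟩ d e hv.2.1 t hv.2.2,
          ← Equiv.Perm.mul_apply, (Commute.pow_pow_self (stp hN) (N d e) (t + 1)).eq,
          Equiv.Perm.mul_apply, stp_o hN ⟨u, hv.1⟩ d e hv.2.1]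

theorem P_pow_self (hN : NOK N) (a : ℕ) : P hN a ^ (N a a) = 1 := by
  have h : ∀ (m : ℕ) (v : X N), (stp hN ^ m) (v, a, a) = ((P hN a ^ m) v, a, a) := by
    intro m
    induction m with
    | zero => intro v; rfl
    | succ m ih => intro v; rw [pow_succ, Equiv.Perm.mul_apply, pow_succ, Equiv.Perm.mul_apply,
                    ← ih]; rfl
  ext v : 1
  have := stp_fix hN v a a
  rw [h] at this
  exact congrArg Prod.fst this

theorem P_pow_mul (hN : NOK N) (a b k : ℕ) (hk : N a b = 2 * k) :
    (P hN a * P hN b) ^ k = 1 := by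
  have h : ∀ (m : ℕ) (v : X N), (stp hN ^ (2 * m)) (v, a, b) =
      (((P hN a * P hN b) ^ m) v, a, b) := by
    intro m
    induction m with
    | zero => intro v; rfl
    | succ m ih =>
      intro v
      have e1 : (P hN a * P hN b) ^ (m + 1) = (P hN a * P hN b) ^ m * (P hN a * P hN b) :=
        pow_succ _ _
      rw [mul_add, pow_add, Equiv.Perm.mul_apply, e1, Equiv.Perm.mul_apply, ← ih]; rfl
  ext v : 1
  have := stp_fix hN v a b
  rw [hk, h] at this
  exact congrArg Prod.fst this

end WG

namespace WG
open V

/-- letters -/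
abbrev L := ℕ × Bool

def alt (s : Bool) : ℕ → ℕ → ℕ → List L
  | _, _, 0 => []
  | a, b, r + 1 => (a, s) :: alt s b a r

theorem alt_zero (s a b) : alt s a b 0 = [] := rfl
theorem alt_succ (s a b r) : alt s a b (r + 1) = (a, s) :: alt s b a r := rfl

theorem alt_length (s : Bool) (a b r : ℕ) : (alt s a b r).length = r := by
  induction r generalizing a b with
  | zero => rfl
  | succ r ih => simp [alt_succ, ih]

theorem alt_initial (s : Bool) (a b r q : ℕ) (h : r ≤ q) : alt s a b r <+: alt s a b q := by
  induction r generalizing a b q with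
  | zero => exact ⟨_, rfl⟩
  | succ r ih =>
    obtain ⟨q, rfl⟩ : ∃ q', q = q' + 1 := ⟨q - 1, by omega⟩
    rw [alt_succ, alt_succ, List.cons_prefix_cons]
    exact ⟨rfl, ih _ _ _ (by omega)⟩

def Good (N : ℕ → ℕ → ℕ) (w : List L) : Prop :=
  (∀ a s, ¬ [(a, s), (a, !s)] <:+: w) ∧ ∀ s a b, ¬ alt s a b (N a b - 2) <:+: w

theorem Good.of_factor {N : ℕ → ℕ → ℕ} {v w : List L} (h : Good N w) (hv : v <:+: w) : Good N v :=
  ⟨fun a s hh => h.1 a s (hh.trans hv), fun s a b hh => h.2 s a b (hh.trans hv)⟩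

def aV (N : ℕ → ℕ → ℕ) : List L → V
  | [] => base
  | (b, true) :: w => fF N b (aV N w)
  | (b, false) :: w => gF N b (aV N w)

def Inv (N : ℕ → ℕ → ℕ) (w : List L) (v : V) : Prop :=
  (∃ u b l, w = (b, true) :: l ∧ v = o u b) ∨
  (∃ u b l, w = (b, false) :: l ∧ v = n u b) ∨
  (∃ u d e t, v = p u d e t ∧ alt true (lab d e t) (lab d e (t + 1)) (t + 2) <+: w) ∨
  (∃ u d e t, v = p u d e t ∧ alt false (lab d e (t + 1)) (lab d e t) (K N u d e - t + 1) <+: w)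

variable {N : ℕ → ℕ → ℕ}

theorem N_lab (hN : NOK N) (d e t : ℕ) : N (lab d e (t + 1)) (lab d e t) = N d e := by
  unfold lab
  split_ifs <;> first | omega | exact hN.symm _ _ | rfl

theorem Inv.oo {b : ℕ} {v : V} (l : List L) (h : outB N v b = none) :
    Inv N ((b, true) :: l) (fF N b v) := Or.inl ⟨v, b, l, rfl, fF_none h⟩

theorem Inv.nn {b : ℕ} {v : V} (l : List L) (h : inB N v b = none) :
    Inv N ((b, false) :: l) (gF N b v) := Or.inr (Or.inl ⟨v, b, l, rfl, gF_none h⟩)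

theorem not_cancel {b c : ℕ} {s : Bool} {l : List L} (h : Good N ((b, s) :: (c, !s) :: l)) :
    b ≠ c := by
  rintro rfl
  exact h.1 b s ⟨[], l, rfl⟩

theorem not_cancel' {b : ℕ} {s : Bool} {w : List L} {a c k : ℕ} (h : Good N ((b, s) :: w))
    (hp : alt (!s) a c (k + 1) <+: w) : b ≠ a := by
  obtain ⟨l, rfl⟩ := hp
  rw [alt_succ] at h
  exact not_cancel h

theorem Inv_step (hN : NOK N) (x : L) (w : List L) (v : V) (hv : valid N v)
    (hg : Good N (x :: w)) (hI : Inv N w v) :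
    Inv N (x :: w) (if x.2 then fF N x.1 v else gF N x.1 v) := by
  obtain ⟨b, s⟩ := x
  rcases hI with ⟨u, c, l, rfl, rfl⟩ | ⟨u, c, l, rfl, rfl⟩ | ⟨u, d, e, t, rfl, hp⟩ |
      ⟨u, d, e, t, rfl, hp⟩
  · cases s with
    | true =>
      refine Or.inr (Or.inr (Or.inl ⟨u, c, b, 0, fF_some rfl, ?_⟩))
      simp [alt, lab_zero, lab_one]
    | false =>
      have := not_cancel hg
      exact Inv.nn _ (by rw [in_o, if_neg this])
  · cases s with
    | true =>
      have := not_cancel hg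
      exact Inv.oo _ (by rw [out_n, if_neg this])
    | false =>
      refine Or.inr (Or.inr (Or.inr ?_))
      cases h : outB N u b with
      | none =>
        refine ⟨u, b, c, N b c - 4, gF_some (in_n_none c h), ?_⟩
        have h7 := hN.ge b c
        rw [K_none b hv.2, show N b c - 3 - (N b c - 4) + 1 = 2 by omega,
          show N b c - 4 + 1 = N b c - 3 by omega, lab_odd hN b c 3 rfl (by omega),
          lab_even hN b c 4 rfl (by omega)]
        simp [alt]
      | some u' =>
        refine ⟨u', c, b, N c b - 5, gF_some (in_n_some c h), ?_⟩
        obtain ⟨h1, h2, h3⟩ := (key hN u hv.1).2 b u' c h hv.2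
        have h7 := hN.ge c b
        rw [K_some c h2, show N c b - 4 - (N c b - 5) + 1 = 2 by omega,
          show N c b - 5 + 1 = N c b - 4 by omega, lab_odd hN c b 5 rfl (by omega),
          lab_even hN c b 4 rfl (by omega)]
        simp [alt]
  · cases s with
    | true =>
      by_cases hb : b = lab d e (t + 1)
      · have hp' : alt true (lab d e (t + 1)) (lab d e t) (t + 3) <+: (b, true) :: w := by
          rw [alt_succ, ← hb, List.cons_prefix_cons]; rw [← hb] at hp; exact ⟨rfl, hp⟩
        by_cases hlt : t + 1 < K N u d e
        · refine Or.inr (Or.inr (Or.inl ⟨u, d, e, t + 1, ?_, ?_⟩))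
          · subst hb; exact fF_some (out_p_lt _ _ _ _ hlt)
          · rw [lab_add_two]; exact hp'
        · exfalso
          refine hg.2 true (lab d e (t + 1)) (lab d e t) (List.IsPrefix.isInfix
            ((alt_initial _ _ _ _ _ ?_).trans hp'))
          rw [N_lab hN]
          have := K_ge N u d e
          omega
      · exact Inv.oo _ (out_p_ne _ _ _ _ _ hb)
    | false =>
      exact Inv.nn _ (in_p_ne _ _ _ _ _ (not_cancel' hg hp))
  · cases s with
    | true =>
      exact Inv.oo _ (out_p_ne _ _ _ _ _ (not_cancel' hg hp))
    | false =>
      by_cases hb : b = lab d e t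
      · have hp' : alt false (lab d e t) (lab d e (t + 1)) (K N u d e - t + 2) <+:
            (b, false) :: w := by
          rw [alt_succ, ← hb, List.cons_prefix_cons]; rw [← hb] at hp; exact ⟨rfl, hp⟩
        cases t with
        | zero =>
          exfalso
          refine hg.2 false (lab d e 0) (lab d e 1) (List.IsPrefix.isInfix
            ((alt_initial _ _ _ _ _ ?_).trans hp'))
          rw [hN.symm, N_lab hN]
          have := K_ge N u d e
          omega
        | succ t =>
          refine Or.inr (Or.inr (Or.inr ⟨u, d, e, t, ?_, ?_⟩))
          · subst hb; exact gF_some (in_p_succ _ _ _ _)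
          · have := hv.2.2
            rw [lab_add_two] at hp'
            rwa [show K N u d e - t + 1 = K N u d e - (t + 1) + 2 by omega]
      · exact Inv.nn _ (in_p_ne _ _ _ _ _ hb)

theorem aV_valid (hN : NOK N) (w : List L) : valid N (aV N w) := by
  induction w with
  | nil => trivial
  | cons x w ih =>
    obtain ⟨b, s⟩ := x
    cases s
    · exact (g_main hN _ ih b).1
    · exact (f_main hN _ ih b).1

theorem aV_inv (hN : NOK N) (w : List L) (hg : Good N w) (h : w ≠ []) : Inv N w (aV N w) := by
  induction w with
  | nil => exact absurd rfl h
  | cons x w ih =>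
    cases w with
    | nil =>
      obtain ⟨b, s⟩ := x
      cases s
      · exact Inv.nn _ rfl
      · exact Inv.oo _ rfl
    | cons y w =>
      have := Inv_step hN x (y :: w) _ (aV_valid hN _) hg
        (ih (hg.of_factor (List.suffix_cons _ _).isInfix) (by simp))
      obtain ⟨b, s⟩ := x
      cases s <;> exact this

theorem aV_ne_base (hN : NOK N) (w : List L) (hg : Good N w) (h : w ≠ []) : aV N w ≠ base := by
  intro hb
  have := aV_inv hN w hg h
  rw [hb] at this
  rcases this with ⟨_, _, _, _, h⟩ | ⟨_, _, _, _, h⟩ | ⟨_, _, _, _, h, _⟩ | ⟨_, _, _, _, h, _⟩ <;>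
    cases h

def pl (hN : NOK N) (x : L) : Equiv.Perm (X N) := cond x.2 (P hN x.1) (P hN x.1)⁻¹

theorem pl_prod (hN : NOK N) (w : List L) :
    ((w.map (pl hN)).prod ⟨base, trivial⟩).1 = aV N w := by
  induction w with
  | nil => rfl
  | cons x w ih =>
    rw [List.map_cons, List.prod_cons, Equiv.Perm.mul_apply]
    obtain ⟨b, s⟩ := x
    cases s
    · show gF N b _ = gF N b _
      rw [ih]
    · show fF N b _ = fF N b _
      rw [ih]

theorem pl_prod_ne (hN : NOK N) (w : List L) (hg : Good N w) (h : w ≠ []) :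
    (w.map (pl hN)).prod ≠ 1 := by
  intro hh
  apply aV_ne_base hN w hg h
  rw [← pl_prod hN, hh]; rfl

end WG

namespace WG

open Classical in
noncomputable def nn (A : ℕ → ℕ → Prop) (a b : ℕ) : ℕ :=
  if a = b then 7 else if A a b then 22 else 26

/-- graph axioms -/
structure IsG (A : ℕ → ℕ → Prop) : Prop where
  symm : ∀ a b, A a b → A b a
  irrefl : ∀ a, ¬ A a a

variable {A : ℕ → ℕ → Prop}

theorem nn_self (A) (a : ℕ) : nn A a a = 7 := by simp [nn]
theorem nn_adj {a b : ℕ} (hA : IsG A) (h : A a b) : nn A a b = 22 := by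
  have : a ≠ b := by rintro rfl; exact hA.irrefl a h
  simp [nn, this, h]
theorem nn_nadj {a b : ℕ} (hab : a ≠ b) (h : ¬ A a b) : nn A a b = 26 := by
  simp [nn, hab, h]
theorem nn_cases (A) (a b : ℕ) : (a = b ∧ nn A a b = 7) ∨ (a ≠ b ∧ A a b ∧ nn A a b = 22) ∨
    (a ≠ b ∧ ¬ A a b ∧ nn A a b = 26) := by
  unfold nn
  split_ifs <;> simp_all

theorem nn_ok (hA : IsG A) : NOK (nn A) where
  symm a b := by
    have h1 : A a b ↔ A b a := ⟨hA.symm a b, hA.symm b a⟩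
    rcases nn_cases A a b with h | h | h <;> rcases nn_cases A b a with h' | h' | h' <;>
      first | omega | (exfalso; tauto) | (exfalso; omega)
  ge a b := by rcases nn_cases A a b with h | h | h <;> omega
  even a b hab := by rcases nn_cases A a b with h | h | h <;> omega

noncomputable def lt (A : ℕ → ℕ → Prop) (x : L) : GT A := cond x.2 (gen A x.1) (gen A x.1)⁻¹

noncomputable def ev (A : ℕ → ℕ → Prop) (w : List L) : GT A := (w.map (lt A)).prod

theorem ev_nil : ev A [] = 1 := rfl
theorem ev_cons (x : L) (w : List L) : ev A (x :: w) = lt A x * ev A w := by simp [ev]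
theorem ev_append (v w : List L) : ev A (v ++ w) = ev A v * ev A w := by simp [ev]
theorem ev_single (x : L) : ev A [x] = lt A x := by simp [ev]

/-- inverse letter -/
def il (x : L) : L := (x.1, !x.2)
theorem il_il (x : L) : il (il x) = x := by simp [il]
theorem lt_il (x : L) : lt A (il x) = (lt A x)⁻¹ := by
  obtain ⟨a, s⟩ := x
  cases s <;> simp [lt, il]

/-- inverse word -/
def iw (w : List L) : List L := (w.map il).reverse
theorem iw_length (w : List L) : (iw w).length = w.length := by simp [iw]
theorem iw_append (v w : List L) : iw (v ++ w) = iw w ++ iw v := by simp [iw]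
theorem iw_cons (x : L) (w : List L) : iw (x :: w) = iw w ++ [il x] := by simp [iw]
theorem iw_nil : iw [] = [] := rfl
theorem iw_iw (w : List L) : iw (iw w) = w := by
  simp only [iw, List.map_reverse, List.reverse_reverse, List.map_map]
  conv_rhs => rw [← List.map_id w]
  exact List.map_congr_left fun x _ => il_il x
theorem ev_iw (w : List L) : ev A (iw w) = (ev A w)⁻¹ := by
  induction w with
  | nil => simp [iw_nil, ev_nil]
  | cons x w ih => rw [iw_cons, ev_append, ih, ev_single, lt_il, ev_cons, mul_inv_rev]

theorem exists_word (g : GT A) : ∃ w, ev A w = g := by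
  have hg : g ∈ (⊤ : Subgroup (GT A)) := trivial
  rw [← PresentedGroup.closure_range_of] at hg
  induction hg using Subgroup.closure_induction with
  | mem x hx =>
    obtain ⟨i, rfl⟩ := hx
    exact ⟨[(i, true)], by rw [ev_single]; rfl⟩
  | one => exact ⟨[], rfl⟩
  | mul x y _ _ hx hy =>
    obtain ⟨v, rfl⟩ := hx
    obtain ⟨w, rfl⟩ := hy
    exact ⟨v ++ w, ev_append _ _⟩
  | inv x _ hx =>
    obtain ⟨v, rfl⟩ := hx
    exact ⟨iw v, ev_iw _⟩

theorem rel_one {r : FreeGroup ℕ} (h : r ∈ grRels A) : (PresentedGroup.mk (grRels A) r) = 1 :=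
  PresentedGroup.one_of_mem h

theorem gen_pow (A) (a : ℕ) : gen A a ^ 7 = 1 := by
  have := rel_one (A := A) (r := FreeGroup.of a ^ 7) (Or.inl ⟨a, rfl⟩)
  rw [map_pow] at this; exact this

theorem gen_mul_pow11 {a b : ℕ} (h : A a b) : (gen A a * gen A b) ^ 11 = 1 := by
  have := rel_one (A := A) (r := (FreeGroup.of a * FreeGroup.of b) ^ 11)
    (Or.inr (Or.inl ⟨a, b, h, rfl⟩))
  rw [map_pow, map_mul] at this; exact this

theorem gen_mul_pow13 {a b : ℕ} (hab : a ≠ b) (h : ¬ A a b) : (gen A a * gen A b) ^ 13 = 1 := by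
  have := rel_one (A := A) (r := (FreeGroup.of a * FreeGroup.of b) ^ 13)
    (Or.inr (Or.inr ⟨a, b, hab, h, rfl⟩))
  rw [map_pow, map_mul] at this; exact this

theorem gen_mul_pow {a b k : ℕ} (hab : a ≠ b) (hk : nn A a b = 2 * k) :
    (gen A a * gen A b) ^ k = 1 := by
  rcases nn_cases A a b with h | h | h
  · exact absurd h.1 hab
  · obtain rfl : k = 11 := by omega
    exact gen_mul_pow11 h.2.1
  · obtain rfl : k = 13 := by omega
    exact gen_mul_pow13 hab h.2.1

theorem lt_pow (a : ℕ) (s : Bool) : lt A (a, s) ^ 7 = 1 := by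
  cases s <;> simp [lt, gen_pow]

theorem lt_mul_pow (hA : IsG A) {a b k : ℕ} {s : Bool} (hab : a ≠ b) (hk : nn A a b = 2 * k) :
    (lt A (a, s) * lt A (b, s)) ^ k = 1 := by
  cases s
  · simp only [lt, cond_false]
    rw [← mul_inv_rev, inv_pow, gen_mul_pow hab.symm (by rw [(nn_ok hA).symm, hk]), inv_one]
  · exact gen_mul_pow hab hk

theorem ev_alt_self (s : Bool) (a r : ℕ) : ev A (alt s a a r) = lt A (a, s) ^ r := by
  induction r with
  | zero => rw [alt_zero, ev_nil, pow_zero]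
  | succ r ih => rw [alt_succ, ev_cons, ih, pow_succ']

theorem alt_self (s : Bool) (a r : ℕ) : alt s a a r = List.replicate r (a, s) := by
  induction r with
  | zero => rfl
  | succ r ih => rw [alt_succ, ih, List.replicate_succ]

theorem ev_replicate (x : L) (r : ℕ) : ev A (List.replicate r x) = lt A x ^ r := by
  simp [ev]

theorem ev_alt_even (s : Bool) (a b k : ℕ) :
    ev A (alt s a b (2 * k)) = (lt A (a, s) * lt A (b, s)) ^ k := by
  induction k with
  | zero => rw [Nat.mul_zero, alt_zero, ev_nil, pow_zero]
  | succ k ih =>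
    rw [Nat.mul_succ, alt_succ, alt_succ, ev_cons, ev_cons, ih, ← mul_assoc, pow_succ']

theorem ev_alt_N (hA : IsG A) (s : Bool) (a b : ℕ) : ev A (alt s a b (nn A a b)) = 1 := by
  by_cases hab : a = b
  · subst hab; rw [ev_alt_self, nn_self, lt_pow]
  · have := (nn_ok hA).even a b hab
    obtain ⟨k, hk⟩ : ∃ k, nn A a b = 2 * k := ⟨nn A a b / 2, by omega⟩
    rw [hk, ev_alt_even, lt_mul_pow hA hab hk]

theorem relhalf (hA : IsG A) (s : Bool) (a b r : ℕ) (hr : r ≤ nn A a b) :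
    ∃ w, w.length = nn A a b - r ∧ ev A w = ev A (alt s a b r) := by
  obtain ⟨l, hl⟩ := alt_initial s a b r _ hr
  have h1 := ev_alt_N hA s a b
  refine ⟨iw l, ?_, ?_⟩
  · have := congrArg List.length hl
    rw [List.length_append, alt_length, alt_length] at this
    rw [iw_length]; omega
  · rw [← hl, ev_append] at h1
    rw [ev_iw]; exact (eq_inv_of_mul_eq_one_left h1).symm

noncomputable def toP (hA : IsG A) : GT A →* Equiv.Perm (X (nn A)) :=
  PresentedGroup.toGroup (f := P (nn_ok hA)) (by
    rintro r (⟨i, rfl⟩ | ⟨i, j, h, rfl⟩ | ⟨i, j, hij, h, rfl⟩)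
    · have := P_pow_self (nn_ok hA) i
      rw [nn_self] at this
      simpa using this
    · have := P_pow_mul (nn_ok hA) i j 11 (nn_adj hA h)
      simpa using this
    · have := P_pow_mul (nn_ok hA) i j 13 (nn_nadj hij h)
      simpa using this)

theorem toP_lt (hA : IsG A) (x : L) : toP hA (lt A x) = pl (nn_ok hA) x := by
  have h : ∀ i, toP hA (gen A i) = P (nn_ok hA) i := fun i => PresentedGroup.toGroup.of _
  obtain ⟨a, s⟩ := x
  cases s
  · show toP hA (gen A a)⁻¹ = (P _ a)⁻¹
    rw [map_inv, h]
  · exact h a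

theorem ev_ne_one (hA : IsG A) {w : List L} (hg : Good (nn A) w) (h : w ≠ []) : ev A w ≠ 1 := by
  intro hh
  apply pl_prod_ne (nn_ok hA) w hg h
  have := congrArg (toP hA) hh
  rw [map_one, ev, map_list_prod, List.map_map] at this
  rw [← this]
  congr 1
  exact List.map_congr_left fun x _ => (toP_lt hA x).symm

end WG

namespace WG

theorem infix_app {α : Type*} {v X Y : List α} (h : v <:+: X ++ Y) :
    v <:+: X ∨ v <:+: Y ∨ ∃ v1 v2, v = v1 ++ v2 ∧ v1 <:+ X ∧ v2 <+: Y := by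
  obtain ⟨p, q, h⟩ := h
  rw [List.append_assoc] at h
  rcases List.append_eq_append_iff.1 h with ⟨c, rfl, h2⟩ | ⟨c, h1, rfl⟩
  · rcases List.append_eq_append_iff.1 h2 with ⟨d, rfl, h3⟩ | ⟨d, rfl, h3⟩
    · exact Or.inl ⟨p, d, by simp⟩
    · exact Or.inr (Or.inr ⟨c, d, rfl, ⟨p, rfl⟩, ⟨q, h3.symm⟩⟩)
  · exact Or.inr (Or.inl ⟨c, q, by simp⟩)

theorem prefix_app {α : Type*} {v X Y : List α} (h : v <+: X ++ Y) :
    v <+: X ∨ ∃ v2, v = X ++ v2 ∧ v2 <+: Y := by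
  obtain ⟨q, h⟩ := h
  rcases List.append_eq_append_iff.1 h with ⟨c, rfl, h2⟩ | ⟨c, h1, rfl⟩
  · exact Or.inl ⟨c, rfl⟩
  · exact Or.inr ⟨c, h1, ⟨q, rfl⟩⟩

theorem suffix_app {α : Type*} {v X Y : List α} (h : v <:+ X ++ Y) :
    v <:+ Y ∨ ∃ v1, v = v1 ++ Y ∧ v1 <:+ X := by
  obtain ⟨q, h⟩ := h
  rcases List.append_eq_append_iff.1 h with ⟨c, rfl, h2⟩ | ⟨c, h1, rfl⟩
  · exact Or.inr ⟨c, h2, ⟨q, rfl⟩⟩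
  · exact Or.inl ⟨c, rfl⟩

theorem prefix_alt {s : Bool} {a b r : ℕ} {v : List L} (h : v <+: alt s a b r) :
    v = alt s a b v.length := by
  have hl := h.length_le
  rw [alt_length] at hl
  have h2 := alt_initial s a b v.length r hl
  have := List.prefix_of_prefix_length_le h h2 (by rw [alt_length])
  exact this.eq_of_length (by rw [alt_length])

theorem suffix_alt {s : Bool} {a b r : ℕ} {v : List L} (h : v <:+ alt s a b r) :
    v = alt s a b v.length ∨ v = alt s b a v.length := by
  induction r generalizing a b with
  | zero => 
    rw [alt_zero, List.suffix_nil] at h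
    subst h; exact Or.inl rfl
  | succ r ih =>
    rw [alt_succ, List.suffix_cons_iff] at h
    rcases h with h | h
    · left; rw [h]; simp [alt_length, alt_succ]
    · exact (ih h).symm

theorem infix_alt {s : Bool} {a b r : ℕ} {v : List L} (h : v <:+: alt s a b r) :
    v = alt s a b v.length ∨ v = alt s b a v.length := by
  obtain ⟨p, q, h⟩ := h
  have h1 : p ++ v = alt s a b (p ++ v).length := prefix_alt ⟨q, h⟩
  have h2 : v <:+ alt s a b (p ++ v).length := by rw [← h1]; exact ⟨p, rfl⟩
  exact suffix_alt h2

theorem mem_alt {s : Bool} {a b r : ℕ} {x : L} (h : x ∈ alt s a b r) :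
    x.2 = s ∧ (x.1 = a ∨ x.1 = b) := by
  induction r generalizing a b with
  | zero => simp [alt_zero] at h
  | succ r ih =>
    rw [alt_succ, List.mem_cons] at h
    rcases h with rfl | h
    · exact ⟨rfl, Or.inl rfl⟩
    · exact ⟨(ih h).1, (ih h).2.symm⟩

theorem alt_add (s : Bool) (a b k j : ℕ) : alt s a b (k + j) =
    alt s a b k ++ (if k % 2 = 0 then alt s a b j else alt s b a j) := by
  induction k generalizing a b with
  | zero => simp [alt_zero]
  | succ k ih =>
    rw [Nat.add_right_comm, alt_succ, alt_succ, ih, List.cons_append]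
    congr 2
    rcases Nat.mod_two_eq_zero_or_one k with h | h
    · rw [if_pos h, if_neg (by omega)]
    · rw [if_neg (by omega), if_pos (by omega)]

variable {A : ℕ → ℕ → Prop}

theorem lt_mul_il (c : ℕ) (s : Bool) : lt A (c, s) * lt A (c, !s) = 1 := by
  have := lt_il (A := A) (c, s)
  change lt A (c, !s) = _ at this
  rw [this, mul_inv_cancel]

theorem short_cancel {u : List L} {c : ℕ} {s : Bool} (h : [(c, s), (c, !s)] <:+: u) :
    ∃ u', ev A u' = ev A u ∧ u'.length < u.length := by
  obtain ⟨p, q, rfl⟩ := h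
  refine ⟨p ++ q, ?_, by simp⟩
  simp only [ev_append, ev_cons, ev_nil, mul_one, mul_assoc]
  rw [← mul_assoc (lt A (c, s)), lt_mul_il, one_mul]

theorem short_alt (hA : IsG A) {u : List L} {c d r : ℕ} {s : Bool} (h : alt s c d r <:+: u)
    (h1 : r ≤ nn A c d) (h2 : nn A c d < 2 * r) :
    ∃ u', ev A u' = ev A u ∧ u'.length < u.length := by
  obtain ⟨p, q, rfl⟩ := h
  obtain ⟨w, hw, he⟩ := relhalf hA s c d r h1
  refine ⟨p ++ w ++ q, ?_, ?_⟩
  · simp only [ev_append, he]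
  · simp [alt_length, hw]; omega

/-- Powers of words -/
def pw (w : List L) (m : ℕ) : List L := (List.replicate m w).flatten

theorem pw_zero (w) : pw w 0 = [] := rfl
theorem pw_succ (w m) : pw w (m + 1) = w ++ pw w m := by simp [pw, List.replicate_succ]
theorem ev_pw (w m) : ev A (pw w m) = ev A w ^ m := by
  induction m with
  | zero => rw [pw_zero, ev_nil, pow_zero]
  | succ m ih => rw [pw_succ, ev_append, ih, pow_succ']

theorem pw_get (w : List L) (m i : ℕ) (h : i < m * w.length) :
    (pw w m)[i]? = w[i % w.length]? := by
  induction m generalizing i with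
  | zero => simp at h
  | succ m ih =>
    rw [pw_succ]
    by_cases hi : i < w.length
    · rw [List.getElem?_append_left hi, Nat.mod_eq_of_lt hi]
    · rw [List.getElem?_append_right (by omega), ih _ (by rw [Nat.succ_mul] at h; omega),
        ← Nat.mod_eq_sub_mod (by omega)]

theorem pw_length (w m) : (pw w m).length = m * w.length := by
  simp [pw]

theorem pw_infix_get {w v : List L} {m : ℕ} (h : v <:+: pw w m) :
    ∃ off, ∀ i < v.length, v[i]? = w[(off + i) % w.length]? := by
  obtain ⟨p, q, h⟩ := h
  refine ⟨p.length, fun i hi => ?_⟩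
  have hl := congrArg List.length h
  simp only [List.length_append, pw_length] at hl
  rw [← pw_get w m _ (by omega), ← h, List.getElem?_append_left (by simp; omega),
    List.getElem?_append_right (by omega)]
  simp

theorem pw_rot (x : L) (t : List L) (m : ℕ) : pw (t ++ [x]) (m + 1) = t ++ pw (x :: t) m ++ [x] := by
  induction m with
  | zero => simp [pw_succ, pw_zero]
  | succ m ih => rw [pw_succ, ih, pw_succ]; simp

theorem pw_factor {u : List L} (p : List L) : ∀ (w : List L) (m : ℕ), p ++ u <+: pw w m →
    ∃ w' m', w'.length = w.length ∧ IsConj (ev A w') (ev A w) ∧ u <+: pw w' m' := by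
  induction p with
  | nil => intro w m h; exact ⟨w, m, rfl, IsConj.refl _, h⟩
  | cons y p ih =>
    intro w m h
    cases m with
    | zero => simp [pw_zero] at h
    | succ m =>
      cases w with
      | nil => simp [pw] at h
      | cons x t =>
        rw [pw_succ, List.cons_append, List.cons_append, List.cons_prefix_cons] at h
        obtain ⟨w', m', h1, h2, h3⟩ := ih (t ++ [x]) (m + 1)
          (h.2.trans (by rw [pw_rot]; exact ⟨[x], by simp⟩))
        refine ⟨w', m', by rw [h1]; simp, h2.trans ?_, h3⟩
        rw [ev_append, ev_single, ev_cons]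
        exact isConj_iff.2 ⟨lt A x, by group⟩

theorem pw_pre {u w : List L} {m : ℕ} (h : u <+: pw w m) (hu : u ≠ []) :
    u <+: w ∨ ∃ u' m', u = w ++ u' ∧ u' <+: pw w m' := by
  cases m with
  | zero => rw [pw_zero, List.prefix_nil] at h; exact absurd h hu
  | succ m =>
    rw [pw_succ] at h
    rcases prefix_app h with h | ⟨v, h1, h2⟩
    · exact Or.inl h
    · exact Or.inr ⟨v, m, h1, h2⟩

theorem alt_inj_len {s : Bool} {a b : ℕ} {w u' : List L} {r : ℕ} (h : alt s a b r = w ++ u') :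
    w = alt s a b w.length ∧ u' = (if w.length % 2 = 0 then alt s a b u'.length
      else alt s b a u'.length) := by
  have hw : w = alt s a b w.length := prefix_alt ⟨u', h.symm⟩
  refine ⟨hw, ?_⟩
  have hr := congrArg List.length h
  rw [alt_length, List.length_append] at hr
  rw [hr, alt_add, ← hw] at h
  exact (List.append_cancel_left h).symm

theorem pow7_conj (a : ℕ) (s : Bool) (k : ℕ) : ∃ s' j, j ≤ 3 ∧
    lt A (a, s) ^ k = lt A (a, s') ^ j := by
  have h7 := lt_pow (A := A) a s
  have h1 : lt A (a, s) ^ k = lt A (a, s) ^ (k % 7) := by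
    conv_lhs => rw [← Nat.div_add_mod k 7, pow_add, pow_mul, h7, one_pow, one_mul]
  by_cases h : k % 7 ≤ 3
  · exact ⟨s, k % 7, h, h1⟩
  · refine ⟨!s, 7 - k % 7, by omega, ?_⟩
    rw [h1, show lt A (a, !s) = (lt A (a, s))⁻¹ from lt_il (a, s), inv_pow]
    apply eq_inv_of_mul_eq_one_left
    rw [← pow_add, show k % 7 + (7 - k % 7) = 7 by omega, h7]

theorem exists_min {S : List L → Prop} (h : ∃ w, S w) :
    ∃ w, S w ∧ ∀ w', S w' → w.length ≤ w'.length := by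
  classical
  have h' : ∃ n w, S w ∧ w.length = n := by obtain ⟨w, hw⟩ := h; exact ⟨_, w, hw, rfl⟩
  obtain ⟨w, hw, hl⟩ := Nat.find_spec h'
  refine ⟨w, hw, fun w' hw' => ?_⟩
  rw [hl]; exact Nat.find_min' h' ⟨w', hw', rfl⟩

theorem F1 (hA : IsG A) (g : GT A) (hg : g ^ 7 = 1) :
    ∃ c a s j, j ≤ 3 ∧ g = c * lt A (a, s) ^ j * c⁻¹ := by
  obtain ⟨w, hw, hmin⟩ := exists_min (S := fun w => IsConj (ev A w) g)
    (by obtain ⟨w, hw⟩ := exists_word g; exact ⟨w, hw ▸ IsConj.refl _⟩)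
  suffices h : ∃ a s k, IsConj (lt A (a, s) ^ k) g by
    obtain ⟨a, s, k, h⟩ := h
    obtain ⟨s', j, hj, h2⟩ := pow7_conj (A := A) a s k
    rw [h2] at h
    obtain ⟨c, hc⟩ := isConj_iff.1 h
    exact ⟨c, a, s', j, hj, hc.symm⟩
  by_cases hnil : w = []
  · subst hnil
    exact ⟨0, true, 0, by rwa [pow_zero, ← ev_nil (A := A)]⟩
  have hlen : 0 < w.length := List.length_pos_iff.2 hnil
  have h7 : ev A w ^ 7 = 1 := by
    obtain ⟨c, hc⟩ := isConj_iff.1 hw.symm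
    rw [← hc, ← MulAut.conj_apply, ← map_pow, hg, map_one]
  have hng : ¬ Good (nn A) (pw w 7) := by
    intro h
    refine ev_ne_one hA h ?_ (by rw [ev_pw, h7])
    rw [← List.length_pos_iff, pw_length]; omega
  have hshort : ∀ w' : List L, w'.length = w.length → IsConj (ev A w') (ev A w) →
      ¬ ∃ u', ev A u' = ev A w' ∧ u'.length < w'.length := by
    rintro w' h1 h2 ⟨u', h3, h4⟩
    have := hmin u' (by rw [h3]; exact h2.trans hw)
    omega
  have hN := nn_ok hA
  unfold Good at hng
  rw [not_and_or] at hng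
  push Not at hng
  rcases hng with ⟨a, s, p, q, h⟩ | ⟨s, a, b, p, q, h⟩
  · exfalso
    obtain ⟨w', m', h1, h2, h3⟩ := pw_factor (A := A) (u := [(a, s), (a, !s)]) p w 7 ⟨q, h⟩
    rcases pw_pre h3 (by simp) with h | ⟨u', m', h, h4⟩
    · exact hshort w' h1 h2 (short_cancel h.isInfix)
    · cases w' with
      | nil => simp at h1; omega
      | cons x w' =>
        cases w' with
        | nil =>
          simp at h
          obtain ⟨rfl, rfl⟩ := h
          cases m' with
          | zero => simp [pw] at h4
          | succ m' => rw [pw_succ] at h4; simp at h4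
        | cons y w' =>
          refine hshort _ h1 h2 (short_cancel (c := a) (s := s) ?_)
          simp at h
          rw [← h.1, ← h.2.1]
          exact ⟨[], w', rfl⟩
  · obtain ⟨w', m', h1, h2, h3⟩ := pw_factor (A := A) (u := alt s a b (nn A a b - 2)) p w 7 ⟨q, h⟩
    have hge := hN.ge a b
    rcases pw_pre h3 (by rw [← List.length_pos_iff, alt_length]; omega) with h | ⟨u', m', h, h4⟩
    · exact absurd (short_alt hA h.isInfix (by omega) (by omega)) (hshort w' h1 h2)
    · obtain ⟨h5, h6⟩ := alt_inj_len h
      by_cases hu : u' = []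
      · rw [hu, List.append_nil] at h
        refine absurd (short_alt hA (s := s) (c := a) (d := b) (r := nn A a b - 2) ?_
          (by omega) (by omega)) (hshort w' h1 h2)
        rw [h]
      obtain ⟨k, hk⟩ : ∃ k, w'.length = k + 1 := ⟨w'.length - 1, by omega⟩
      obtain ⟨r, hr⟩ : ∃ r, u'.length = r + 1 :=
        ⟨u'.length - 1, by have := List.length_pos_iff.2 hu; omega⟩
      by_cases hab : a = b
      · subst hab
        refine ⟨a, s, w'.length, ?_⟩
        rw [← ev_alt_self, ← h5]; exact h2.trans hw
      exfalso
      have heven : w'.length % 2 = 0 := by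
        by_contra hodd
        rw [if_neg hodd, hr, alt_succ] at h6
        rw [hk, alt_succ] at h5
        cases m' with
        | zero => rw [pw_zero, List.prefix_nil] at h4; exact hu h4
        | succ m' =>
          rw [pw_succ, h6, h5, List.cons_append, List.cons_prefix_cons] at h4
          exact hab (congrArg Prod.fst h4.1).symm
      obtain ⟨i, hi⟩ : ∃ i, w'.length = 2 * i := ⟨w'.length / 2, by omega⟩
      have he : ev A w' = (lt A (a, s) * lt A (b, s)) ^ i := by
        rw [h5, hi, ev_alt_even]
      have h7' : ev A w' ^ 7 = 1 := by
        obtain ⟨c, hc⟩ := isConj_iff.1 h2.symm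
        rw [← hc, ← MulAut.conj_apply, ← map_pow, h7, map_one]
      have h1' : ev A w' = 1 := by
        have hq : ∀ q, nn A a b = 2 * q → Nat.Coprime 7 q → ev A w' = 1 := by
          intro q hq hc
          have hx : ev A w' ^ q = 1 := by
            rw [he, ← pow_mul, mul_comm, pow_mul, lt_mul_pow hA hab hq, one_pow]
          have := pow_gcd_eq_one.2 ⟨h7', hx⟩
          rwa [hc, pow_one] at this
        rcases nn_cases A a b with h | h | h
        · exact absurd h.1 hab
        · exact hq 11 h.2.2 (by norm_num)
        · exact hq 13 h.2.2 (by norm_num)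
      exact hshort w' h1 h2 ⟨[], by rw [h1', ev_nil], by simp; omega⟩

end WG

namespace WG
variable {A : ℕ → ℕ → Prop}

theorem infix_junction {α : Type*} {v X B Y : List α} {z z' : α}
    (h : v <:+: (X ++ [z]) ++ B ++ z' :: Y) :
    v <:+: (X ++ [z]) ++ B ∨ v <:+: B ++ z' :: Y ∨
      (z ∈ v ∧ z' ∈ v ∧ B.length + 2 ≤ v.length) := by
  rcases infix_app h with h | h | ⟨v1, v2, rfl, h1, h2⟩
  · exact Or.inl h
  · exact Or.inr (Or.inl (h.trans (List.suffix_append _ _).isInfix))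
  · cases v2 with
    | nil => left; rw [List.append_nil]; exact h1.isInfix
    | cons y v2 =>
      rw [List.cons_prefix_cons] at h2
      obtain ⟨rfl, h2⟩ := h2
      rcases suffix_app h1 with h | ⟨v1, rfl, h3⟩
      · right; left
        obtain ⟨p, rfl⟩ := h
        obtain ⟨q, rfl⟩ := h2
        exact ⟨p, q, by simp⟩
      · rcases suffix_app h3 with h | ⟨v1, rfl, h4⟩
        · rcases List.suffix_cons_iff.1 h with rfl | h
          · right; right; refine ⟨by simp, by simp, by simp <;> omega⟩
          · rw [List.suffix_nil] at h
            subst h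
            right; left
            obtain ⟨q, rfl⟩ := h2
            exact ⟨[], q, by simp⟩
        · right; right; refine ⟨by simp, by simp, by simp <;> omega⟩

theorem Good_junction {N : ℕ → ℕ → ℕ} {X B Y : List L} {z : L} (hB : B ≠ [])
    (h1 : Good N ((X ++ [z]) ++ B)) (h2 : Good N (B ++ il z :: Y)) :
    Good N ((X ++ [z]) ++ B ++ il z :: Y) := by
  have hl := List.length_pos_iff.2 hB
  constructor
  · intro a s h
    rcases infix_junction h with h | h | ⟨_, _, h⟩
    · exact h1.1 a s h
    · exact h2.1 a s h
    · simp only [List.length_cons, List.length_nil] at h; omega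
  · intro s a b h
    rcases infix_junction h with h | h | ⟨h, h', _⟩
    · exact h1.2 s a b h
    · exact h2.2 s a b h
    · have e1 := (mem_alt h).1
      have e2 := (mem_alt h').1
      simp [il] at e2
      rw [e1] at e2; cases s <;> simp at e2

theorem infix_three {α : Type*} {v X u Y : List α} (h : v <:+: X ++ (u ++ Y)) :
    ∃ x v' y, v = x ++ v' ++ y ∧ x <:+: X ∧ v' <:+: u ∧ y <:+: Y ∧ (x = [] ∨ v' <+: u) ∧
      (y = [] ∨ v' <:+ u) ∧ (x = [] ∨ y = [] ∨ v' = u) := by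
  rcases infix_app h with h | h | ⟨v1, v2, rfl, h1, h2⟩
  · exact ⟨v, [], [], by simp, h, by simp, by simp, by simp, by simp, by simp⟩
  · rcases infix_app h with h | h | ⟨v1, v2, rfl, h1, h2⟩
    · exact ⟨[], v, [], by simp, by simp, h, by simp, by simp, by simp, by simp⟩
    · exact ⟨[], [], v, by simp, by simp, by simp, h, by simp, by simp, by simp⟩
    · exact ⟨[], v1, v2, by simp, by simp, h1.isInfix, h2.isInfix, by simp, Or.inr h1, by simp⟩
  · rcases prefix_app h2 with h | ⟨v2, rfl, h3⟩
    · exact ⟨v1, v2, [], by simp, h1.isInfix, h.isInfix, by simp, Or.inr h, by simp, by simp⟩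
    · exact ⟨v1, u, v2, by simp, h1.isInfix, List.infix_rfl, h3.isInfix, by simp, by simp,
        by simp⟩

/-- `u` is shortest in its double coset -/
def DMin (A : ℕ → ℕ → Prop) (a b : ℕ) (u : List L) : Prop :=
  ∀ u', (∃ p q : ℤ, ev A u = gen A a ^ p * ev A u' * gen A b ^ q) → u.length ≤ u'.length

theorem DMin.le {a b : ℕ} {u u' : List L} (h : DMin A a b u) (he : ev A u' = ev A u) :
    u.length ≤ u'.length := h u' ⟨0, 0, by simp [he]⟩

theorem DMin.iw {a b : ℕ} {u : List L} (h : DMin A a b u) : DMin A b a (iw u) := by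
  rintro u' ⟨p, q, hu⟩
  rw [iw_length, ← iw_length u']
  apply h
  refine ⟨-q, -p, ?_⟩
  rw [ev_iw] at hu ⊢
  rw [inv_eq_iff_eq_inv] at hu
  rw [hu]; group

theorem lt_zpow (a : ℕ) (s : Bool) : ∃ p : ℤ, lt A (a, s) = gen A a ^ p := by
  cases s
  · exact ⟨-1, by simp [lt]⟩
  · exact ⟨1, by simp [lt]⟩

theorem DMin.head {a b : ℕ} {u : List L} {z : L} (h : DMin A a b (z :: u)) : z.1 ≠ a := by
  obtain ⟨c, s⟩ := z
  rintro rfl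
  obtain ⟨p, hp⟩ := lt_zpow (A := A) c s
  have := h u ⟨p, 0, by simp [ev_cons, hp]⟩
  simp at this

theorem DMin.last {a b : ℕ} {u : List L} {z : L} (h : DMin A a b (u ++ [z])) : z.1 ≠ b := by
  obtain ⟨c, s⟩ := z
  rintro rfl
  obtain ⟨p, hp⟩ := lt_zpow (A := A) c s
  have := h u ⟨0, p, by simp [ev_append, ev_single, hp]⟩
  simp at this

theorem Good_AuB (hA : IsG A) {a b : ℕ} {s s' : Bool} {j l : ℕ} (hj : j ≤ 3) (hl : l ≤ 3)
    {u : List L} (hu : u ≠ []) (hm : DMin A a b u) :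
    Good (nn A) (List.replicate j (a, s) ++ (u ++ List.replicate l (b, s'))) := by
  have hN := nn_ok hA
  have main : ∀ v : List L, v <:+: List.replicate j (a, s) ++ (u ++ List.replicate l (b, s')) →
      ∃ x v' y, v = x ++ v' ++ y ∧ v' <:+: u ∧ x.length ≤ 3 ∧ y.length ≤ 3 ∧
      (∀ t ∈ x, t = (a, s)) ∧ (∀ t ∈ y, t = (b, s')) ∧
      (x ≠ [] → v' ≠ [] → ∃ z ∈ v', z.1 ≠ a ∧ v'.head? = some z) ∧
      (y ≠ [] → v' ≠ [] → ∃ z ∈ v', z.1 ≠ b ∧ v'.getLast? = some z) ∧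
      (x ≠ [] → y ≠ [] → v' ≠ []) := by
    intro v hv
    obtain ⟨x, v', y, h1, h2, h3, h4, h5, h6, h7⟩ := infix_three hv
    refine ⟨x, v', y, h1, h3, ?_, ?_, ?_, ?_, ?_, ?_, ?_⟩
    · have := h2.length_le; simp at this; omega
    · have := h4.length_le; simp at this; omega
    · intro t ht; exact List.eq_of_mem_replicate (h2.subset ht)
    · intro t ht; exact List.eq_of_mem_replicate (h4.subset ht)
    · intro hx hv'
      cases v' with
      | nil => exact absurd rfl hv'
      | cons z v' =>
        refine ⟨z, by simp, ?_, rfl⟩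
        rcases h5 with h | ⟨q, rfl⟩
        · exact absurd h hx
        · exact DMin.head hm
    · intro hy hv'
      rcases List.eq_nil_or_concat' v' with h | ⟨v'', z, rfl⟩
      · exact absurd h hv'
      · refine ⟨z, by simp, ?_, by simp⟩
        rcases h6 with h | ⟨q, rfl⟩
        · exact absurd h hy
        · rw [← List.append_assoc] at hm
          exact DMin.last hm
    · intro hx hy
      rcases h7 with h | h | h
      · exact absurd h hx
      · exact absurd h hy
      · rwa [h]
  constructor
  · intro c t hv
    obtain ⟨x, v', y, h1, h2, h3, h4, h5, h6, h7, h8, h9⟩ := main _ hv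
    have hlab : ∀ z ∈ x ++ v' ++ y, z.1 = c := by
      rw [← h1]; simp
    by_cases hv' : v' = []
    · subst hv'
      by_cases hx : x = []
      · subst hx
        have e1 := h6 (c, t) (by simp at h1; rw [← h1]; simp)
        have e2 := h6 (c, !t) (by simp at h1; rw [← h1]; simp)
        rw [← e1] at e2; cases t <;> simp at e2
      · by_cases hy : y = []
        · subst hy
          have e1 := h5 (c, t) (by simp at h1; rw [← h1]; simp)
          have e2 := h5 (c, !t) (by simp at h1; rw [← h1]; simp)
          rw [← e1] at e2; cases t <;> simp at e2
        · exact h9 hx hy rfl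
    · by_cases hx : x = []
      · by_cases hy : y = []
        · subst hx hy
          simp at h1
          obtain ⟨u', e1, e2⟩ := short_cancel (A := A) (h1 ▸ h2)
          have := hm.le e1
          omega
        · obtain ⟨z, hz, h, _⟩ := h8 hy hv'
          obtain ⟨t', ht'⟩ := List.exists_mem_of_ne_nil _ hy
          have e1 := hlab z (by simp [hz])
          have e2 := hlab t' (by simp [ht'])
          rw [h6 t' ht'] at e2
          exact h (e1.trans e2.symm)
      · obtain ⟨z, hz, h, _⟩ := h7 hx hv'
        obtain ⟨t', ht'⟩ := List.exists_mem_of_ne_nil _ hx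
        have e1 := hlab z (by simp [hz])
        have e2 := hlab t' (by simp [ht'])
        rw [h5 t' ht'] at e2
        exact h (e1.trans e2.symm)
  · intro t c d hv
    obtain ⟨x, v', y, h1, h2, h3, h4, h5, h6, h7, h8, h9⟩ := main _ hv
    have hlen := congrArg List.length h1
    rw [alt_length, List.length_append, List.length_append] at hlen
    have hva : v' <:+: alt t c d (nn A c d - 2) := ⟨x, y, h1.symm⟩
    have h7c := hN.ge c d
    have hvl : 2 * v'.length ≤ nn A c d := by
      by_contra hlt
      have : ∃ u', ev A u' = ev A u ∧ u'.length < u.length := by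
        rcases infix_alt hva with h | h
        · exact short_alt hA (h ▸ h2) (by omega) (by omega)
        · exact short_alt hA (h ▸ h2) (by rw [hN.symm]; omega) (by rw [hN.symm]; omega)
      obtain ⟨u', e1, e2⟩ := this
      have := hm.le e1
      omega
    rcases nn_cases A c d with h | h | h
    · obtain ⟨rfl, h⟩ := h
      have hlab : ∀ z ∈ x ++ v' ++ y, z.1 = c := by
        intro z hz; rw [← h1] at hz; simpa using (mem_alt hz).2
      by_cases hv' : v' = []
      · subst hv'
        simp only [List.length_nil] at hlen
        refine h9 ?_ ?_ rfl
        · rintro rfl; simp at hlen; omega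
        · rintro rfl; simp at hlen; omega
      · by_cases hx : x = []
        · by_cases hy : y = []
          · subst hx hy
            simp at hlen; omega
          · obtain ⟨z, hz, h, _⟩ := h8 hy hv'
            obtain ⟨t', ht'⟩ := List.exists_mem_of_ne_nil _ hy
            have e1 := hlab z (by simp [hz])
            have e2 := hlab t' (by simp [ht'])
            rw [h6 t' ht'] at e2
            exact h (e1.trans e2.symm)
        · obtain ⟨z, hz, h, _⟩ := h7 hx hv'
          obtain ⟨t', ht'⟩ := List.exists_mem_of_ne_nil _ hx
          have e1 := hlab z (by simp [hz])
          have e2 := hlab t' (by simp [ht'])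
          rw [h5 t' ht'] at e2
          exact h (e1.trans e2.symm)
    · omega
    · omega

theorem Good_chain {N : ℕ → ℕ → ℕ} {Q B u : List L} (hQ : Q ≠ []) (hB : B ≠ []) (hu : u ≠ [])
    (h1 : Good N (Q ++ (u ++ B))) (h2 : Good N (B ++ (iw u ++ Q))) (m : ℕ) :
    Good N (pw (Q ++ (u ++ (B ++ iw u))) m ++ (Q ++ (u ++ B))) := by
  induction m with
  | zero => simpa [pw_zero] using h1
  | succ m ih =>
    obtain ⟨y, u1, rfl⟩ := List.exists_cons_of_ne_nil hu
    -- the remaining word starts with `Q ++ y :: _`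
    obtain ⟨R, hR⟩ : ∃ R, pw (Q ++ (y :: u1 ++ (B ++ iw (y :: u1)))) m ++
        (Q ++ (y :: u1 ++ B)) = Q ++ y :: R := by
      cases m with
      | zero => exact ⟨u1 ++ B, by simp [pw_zero]⟩
      | succ m => rw [pw_succ]; exact ⟨u1 ++ (B ++ iw (y :: u1)) ++ (pw (Q ++ (y :: u1 ++ (B ++
          iw (y :: u1)))) m ++ (Q ++ (y :: u1 ++ B))), by simp⟩
    rw [pw_succ, List.append_assoc, hR]
    rw [hR] at ih
    have s1 : Good N ((B ++ iw u1 ++ [il y]) ++ Q ++ il (il y) :: R) := by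
      refine Good_junction hQ ?_ (by rw [il_il]; exact ih)
      rw [iw_cons] at h2
      simpa using h2
    rw [il_il] at s1
    rcases List.eq_nil_or_concat' (y :: u1) with h | ⟨u2, z, h⟩
    · simp at h
    · have e1 : iw u1 ++ [il y] = il z :: iw u2 := by
        rw [← iw_cons, h, iw_append]; simp [iw]
      have s2 := Good_junction (N := N) (X := Q ++ u2) (z := z) (B := B) (Y := iw u2 ++ Q ++ y :: R)
        hB (by rw [h] at h1; simpa using h1) (by
          have : B ++ il z :: (iw u2 ++ Q ++ y :: R) = B ++ (iw u1 ++ [il y]) ++ Q ++ y :: R := by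
            rw [e1]; simp
          rw [this]; simpa using s1)
      have e2 : Q ++ (y :: u1 ++ (B ++ iw (y :: u1))) ++ (Q ++ y :: R) =
          Q ++ u2 ++ [z] ++ B ++ il z :: (iw u2 ++ Q ++ y :: R) := by
        rw [iw_cons, e1, h]; simp
      rw [e2]; exact s2

theorem alt_get (s : Bool) (c d r i : ℕ) (h : i < r) :
    (alt s c d r)[i]? = some (if i % 2 = 0 then c else d, s) := by
  induction r generalizing c d i with
  | zero => omega
  | succ r ih =>
    rw [alt_succ]
    cases i with
    | zero => simp
    | succ i =>
      rw [List.getElem?_cons_succ, ih _ _ _ (by omega)]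
      rcases Nat.mod_two_eq_zero_or_one i with h | h
      · rw [if_pos h, if_neg (by omega)]
      · rw [if_neg (by omega), if_pos (by omega)]

theorem AB_get (x y : L) (j l i : ℕ) (h : i < j + l) :
    (List.replicate j x ++ List.replicate l y)[i]? = some (if i < j then x else y) := by
  by_cases hi : i < j
  · rw [List.getElem?_append_left (by simpa using hi), if_pos hi]; simp [hi]
  · rw [List.getElem?_append_right (by simp; omega), if_neg hi, List.length_replicate,
      List.getElem?_replicate, if_pos (by omega)]

theorem Good_AB (hA : IsG A) {a b : ℕ} {s s' : Bool} {j l : ℕ} (hj : j ≤ 3) (hl : l ≤ 3)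
    (hj1 : 1 ≤ j) (hl1 : 1 ≤ l) (hab : a ≠ b) (hn : ¬ (j = 1 ∧ l = 1 ∧ s = s')) (m : ℕ) :
    Good (nn A) (pw (List.replicate j (a, s) ++ List.replicate l (b, s')) m) := by
  have key : ∀ v : List L,
      v <:+: pw (List.replicate j (a, s) ++ List.replicate l (b, s')) m →
      ∃ off, ∀ i < v.length, v[i]? = some (if (off + i) % (j + l) < j then (a, s) else (b, s')) := by
    intro v hv
    obtain ⟨off, h⟩ := pw_infix_get hv
    refine ⟨off, fun i hi => ?_⟩
    rw [h i hi]
    have : (List.replicate j (a, s) ++ List.replicate l (b, s')).length = j + l := by simp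
    rw [this, AB_get]
    exact Nat.mod_lt _ (by omega)
  constructor
  · intro c t hv
    obtain ⟨off, h⟩ := key _ hv
    have h0 := h 0 (by simp)
    have h1 := h 1 (by simp)
    simp only [List.getElem?_cons_zero, List.getElem?_cons_succ, Option.some.injEq] at h0 h1
    split_ifs at h0 h1 <;> simp only [Prod.mk.injEq] at h0 h1 <;> 
      first | (exact hab (by omega)) | (obtain ⟨-, rfl⟩ := h0; have := h1.2; cases t <;> simp at this)
  · intro t c d hv
    have h7 := (nn_ok hA).ge c d
    obtain ⟨off, h⟩ := key _ hv
    rw [alt_length] at h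
    have h' : ∀ i < 5, (if i % 2 = 0 then c else d, t) =
        (if (off + i) % (j + l) < j then (a, s) else (b, s')) := by
      intro i hi
      have := h i (by omega)
      rw [alt_get _ _ _ _ _ (by omega)] at this
      exact Option.some.inj this
    have h0 := h' 0 (by norm_num)
    have h1 := h' 1 (by norm_num)
    have h2 := h' 2 (by norm_num)
    have h3 := h' 3 (by norm_num)
    have h4 := h' 4 (by norm_num)
    clear h' h key
    norm_num at h0 h1 h2 h3 h4
    have e : ∀ i k, (if (off + i) % (j + l) < j then (a, s) else (b, s')) =
      (if (off + k) % (j + l) < j then (a, s) else (b, s')) →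
      ((off + i) % (j + l) < j ↔ (off + k) % (j + l) < j) := by
      intro i k hh
      by_cases q1 : (off + i) % (j + l) < j <;> by_cases q2 : (off + k) % (j + l) < j
      · exact ⟨fun _ => q2, fun _ => q1⟩
      · rw [if_pos q1, if_neg q2] at hh; exact absurd (congrArg Prod.fst hh) hab
      · rw [if_neg q1, if_pos q2] at hh; exact absurd (congrArg Prod.fst hh).symm hab
      · exact ⟨fun h => absurd h q1, fun h => absurd h q2⟩
    have e02 := e 0 2 (h0.symm.trans h2)
    have e13 := e 1 3 (h1.symm.trans h3)
    have e24 := e 2 4 (h2.symm.trans h4)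
    clear h2 h3 h4 e
    interval_cases j <;> interval_cases l <;> first | omega | skip
    apply hn
    refine ⟨rfl, rfl, ?_⟩
    split_ifs at h0 h1 <;> first | omega | simp_all

theorem F2 (hA : IsG A) {a b : ℕ} {s s' : Bool} {j l : ℕ} (hj : j ≤ 3) (hl : l ≤ 3)
    (hj1 : 1 ≤ j) (hl1 : 1 ≤ l) (g : GT A) (m : ℕ)
    (h : (lt A (a, s) ^ j * g * lt A (b, s') ^ l * g⁻¹) ^ (m + 1) = 1) :
    (∃ p q : ℤ, g = gen A a ^ p * gen A b ^ q) ∧ (a ≠ b → j = 1 ∧ l = 1 ∧ s = s') := by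
  obtain ⟨u, ⟨p, q, hg⟩, hmin⟩ := exists_min
    (S := fun u => ∃ p q : ℤ, g = gen A a ^ p * ev A u * gen A b ^ q)
    (by obtain ⟨w, hw⟩ := exists_word g; exact ⟨w, 0, 0, by simp [hw]⟩)
  have hm : DMin A a b u := by
    rintro u' ⟨p', q', hu'⟩
    refine hmin u' ⟨p + p', q' + q, ?_⟩
    rw [hg, hu', zpow_add, zpow_add]; group
  set Q := List.replicate j ((a, s) : L) with hQ
  set B := List.replicate l ((b, s') : L) with hB
  have hconj : lt A (a, s) ^ j * g * lt A (b, s') ^ l * g⁻¹ =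
      gen A a ^ p * (ev A Q * ev A u * ev A B * (ev A u)⁻¹) * (gen A a ^ p)⁻¹ := by
    have c1 : gen A a ^ p * lt A (a, s) ^ j = lt A (a, s) ^ j * gen A a ^ p := by
      obtain ⟨i, hi⟩ := lt_zpow (A := A) a s
      rw [hi]; exact ((Commute.refl (gen A a)).zpow_zpow p i).pow_right j
    have c2 : gen A b ^ q * lt A (b, s') ^ l * (gen A b ^ q)⁻¹ = lt A (b, s') ^ l := by
      obtain ⟨i, hi⟩ := lt_zpow (A := A) b s'
      rw [hi, mul_inv_eq_iff_eq_mul]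
      exact ((Commute.refl (gen A b)).zpow_zpow q i).pow_right l
    rw [hQ, hB, ev_replicate, ev_replicate]
    calc _ = lt A (a, s) ^ j * gen A a ^ p * ev A u *
        (gen A b ^ q * lt A (b, s') ^ l * (gen A b ^ q)⁻¹) * (ev A u)⁻¹ * (gen A a ^ p)⁻¹ := by
          rw [hg]; group
      _ = _ := by rw [c2, ← c1]; group
  have h2 : (ev A Q * ev A u * ev A B * (ev A u)⁻¹) ^ (m + 1) = 1 := by
    rw [hconj, conj_pow] at h
    exact conj_eq_one_iff.1 h
  have hQl : Q ≠ [] := by rw [← List.length_pos_iff, hQ]; simp; omega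
  have hBl : B ≠ [] := by rw [← List.length_pos_iff, hB]; simp; omega
  by_cases hu : u = []
  · subst hu
    refine ⟨⟨p, q, by simpa [ev_nil] using hg⟩, fun hab => ?_⟩
    by_contra hn
    refine ev_ne_one hA (Good_AB hA hj hl hj1 hl1 hab hn (m + 1)) ?_ ?_
    · rw [pw_succ]; simp; intro; omega
    · rw [ev_pw, ev_append]; simpa [ev_nil] using h2
  · exfalso
    have g1 : Good (nn A) (Q ++ (u ++ B)) := Good_AuB hA hj hl hu hm
    have g2 : Good (nn A) (B ++ (iw u ++ Q)) := Good_AuB hA hl hj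
      (by rw [← List.length_pos_iff, iw_length]; exact List.length_pos_iff.2 hu) hm.iw
    have g3 := (Good_chain hQl hBl hu g1 g2 (m + 1)).of_factor (List.prefix_append _ _).isInfix
    refine ev_ne_one hA g3 ?_ ?_
    · rw [pw_succ]; simp [hQl]
    · rw [ev_pw, ev_append, ev_append, ev_append, ev_iw, ← h2]; congr 1; group

end WG

namespace WG
variable {A : ℕ → ℕ → Prop}

theorem good_short (hA : IsG A) {w : List L} (hl : w.length ≤ 4)
    (h : ∀ a s, ¬ [(a, s), (a, !s)] <:+: w) : Good (nn A) w := by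
  refine ⟨h, fun s a b hh => ?_⟩
  have := hh.length_le
  rw [alt_length] at this
  have := (nn_ok hA).ge a b
  omega

theorem gen_ne_one (hA : IsG A) (a : ℕ) : gen A a ≠ 1 := by
  have := ev_ne_one hA (w := [(a, true)]) (good_short hA (by simp) (by
    intro b s h
    have := h.length_le
    simp at this)) (by simp)
  rwa [ev_single] at this

theorem orderOf_gen (hA : IsG A) (a : ℕ) : orderOf (gen A a) = 7 :=
  haveI : Fact (Nat.Prime 7) := ⟨by norm_num⟩
  orderOf_eq_prime (gen_pow A a) (gen_ne_one hA a)

theorem gen_zpow_eq_one (hA : IsG A) (a : ℕ) (p : ℤ) : gen A a ^ p = 1 ↔ (7 : ℤ) ∣ p := by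
  rw [← orderOf_dvd_iff_zpow_eq_one, orderOf_gen hA]; rfl

theorem pair_ne_one (hA : IsG A) {a b : ℕ} (hab : a ≠ b) (s t : Bool) :
    lt A (a, s) * lt A (b, t) ≠ 1 := by
  have := ev_ne_one hA (w := [(a, s), (b, t)]) (good_short hA (by simp) (by
    intro c r h
    have := h.eq_of_length (by simp)
    simp at this
    omega)) (by simp)
  rwa [ev_cons, ev_single] at this

theorem not_comm (hA : IsG A) {a b : ℕ} (hab : a ≠ b) : gen A a * gen A b ≠ gen A b * gen A a := by
  intro hc
  have := ev_ne_one hA (w := [(a, true), (b, true), (a, false), (b, false)])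
    (good_short hA (by simp) (by
      rintro c r ⟨p, q, h⟩
      rcases p with _ | ⟨x, _ | ⟨y, _ | ⟨z, _ | ⟨z', p⟩⟩⟩⟩ <;> simp at h <;> grind)) (by simp)
  apply this
  simp only [ev_cons, ev_nil, lt, cond_true, cond_false, mul_one]
  rw [← mul_assoc, hc]; group

theorem zpow_lt (hA : IsG A) (a : ℕ) (p : ℤ) (hp : ¬ (7 : ℤ) ∣ p) :
    ∃ s j, 1 ≤ j ∧ j ≤ 3 ∧ gen A a ^ p = lt A (a, s) ^ j := by
  have h1 : gen A a ^ p = gen A a ^ (p % 7).toNat := by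
    rw [← zpow_natCast, Int.toNat_of_nonneg (by omega)]
    have := zpow_mod_orderOf (gen A a) p
    rw [orderOf_gen hA] at this
    exact this.symm
  obtain ⟨s, j, hj, h⟩ := pow7_conj (A := A) a true (p % 7).toNat
  refine ⟨s, j, ?_, hj, h1.trans h⟩
  by_contra h0
  obtain rfl : j = 0 := by omega
  rw [pow_zero] at h
  exact hp ((gen_zpow_eq_one hA a p).1 (h1.trans h))

theorem F4 (hA : IsG A) {a b : ℕ} (hab : a ≠ b) {p q : ℤ} (hp : ¬ (7 : ℤ) ∣ p)
    (hq : ¬ (7 : ℤ) ∣ q) (m : ℕ) (h : (gen A a ^ p * gen A b ^ q) ^ (m + 1) = 1) :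
    ∃ s, gen A a ^ p * gen A b ^ q = lt A (a, s) * lt A (b, s) := by
  obtain ⟨s, j, hj1, hj, h1⟩ := zpow_lt hA a p hp
  obtain ⟨t, l, hl1, hl, h2⟩ := zpow_lt hA b q hq
  rw [h1, h2] at h
  obtain ⟨rfl, rfl, rfl⟩ := (F2 hA hj hl hj1 hl1 1 m (by simpa using h)).2 hab
  exact ⟨s, by rw [h1, h2, pow_one, pow_one]⟩

theorem F5 (hA : IsG A) {a b : ℕ} (hab : a ≠ b) {p q : ℤ}
    (h : gen A a ^ p * gen A b ^ q = 1) : (7 : ℤ) ∣ p := by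
  by_contra hp
  have hq : ¬ (7 : ℤ) ∣ q := by
    intro hq
    rw [(gen_zpow_eq_one hA b q).2 hq, mul_one, gen_zpow_eq_one hA] at h
    exact hp h
  obtain ⟨s, hs⟩ := F4 hA hab hp hq 0 (by rw [h, one_pow])
  exact pair_ne_one hA hab s s (hs ▸ h)

theorem lt_mul_pow' (hA : IsG A) {a b : ℕ} (s : Bool) (hab : a ≠ b) :
    (lt A (a, s) * lt A (b, s)) ^ 11 = 1 ∨ (lt A (a, s) * lt A (b, s)) ^ 13 = 1 := by
  rcases nn_cases A a b with h | h | h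
  · exact absurd h.1 hab
  · exact Or.inl (lt_mul_pow hA hab h.2.2)
  · exact Or.inr (lt_mul_pow hA hab h.2.2)

theorem one_of_pows {G : Type*} [Group G] {x : G} {m k : ℕ} (h1 : x ^ m = 1) (h2 : x ^ k = 1)
    (h : Nat.gcd m k = 1) : x = 1 := by
  have := pow_gcd_eq_one.2 ⟨h1, h2⟩
  rwa [h, pow_one] at this

theorem F3 (hA : IsG A) {a b c : ℕ} (hab : a ≠ b) (hac : a ≠ c) {p q r : ℤ}
    (h : gen A a ^ p * gen A c ^ q = gen A b ^ r) : (7 : ℤ) ∣ p := by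
  by_contra hp
  by_cases hq : (7 : ℤ) ∣ q
  · rw [(gen_zpow_eq_one hA c q).2 hq, mul_one] at h
    exact hp (F5 hA hab (q := -r) (by rw [h]; group))
  · have h7 : (gen A a ^ p * gen A c ^ q) ^ 7 = 1 := by
      rw [h, ← zpow_natCast, ← zpow_mul, mul_comm, zpow_mul, zpow_natCast, gen_pow, one_zpow]
    obtain ⟨s, hs⟩ := F4 hA hac hp hq 6 h7
    rw [hs] at h7
    apply pair_ne_one hA hac s s
    rcases lt_mul_pow' hA s hac with h | h
    · exact one_of_pows h7 h (by norm_num)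
    · exact one_of_pows h7 h (by norm_num)

theorem adj_iff (hA : IsG A) {a b : ℕ} (s : Bool) (hab : a ≠ b) :
    A a b ↔ (lt A (a, s) * lt A (b, s)) ^ 11 = 1 := by
  constructor
  · intro h; exact lt_mul_pow hA hab (nn_adj hA h)
  · intro h
    by_contra hn
    exact pair_ne_one hA hab s s
      (one_of_pows h (lt_mul_pow hA hab (k := 13) (nn_nadj hab hn)) (by norm_num))

theorem gen_zpow_comm (a : ℕ) (s : Bool) (p : ℤ) :
    gen A a ^ p * lt A (a, s) * (gen A a ^ p)⁻¹ = lt A (a, s) := by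
  obtain ⟨i, hi⟩ := lt_zpow (A := A) a s
  rw [hi, mul_inv_eq_iff_eq_mul]
  exact (Commute.refl (gen A a)).zpow_zpow p i

theorem structure_thm (hA : IsG A) (h : GT A ≃* GT A) :
    ∃ (c : GT A) (s : Bool) (ρ : ℕ ≃ ℕ), (∀ i j, A i j ↔ A (ρ i) (ρ j)) ∧
      ∀ i, h (gen A i) = c * lt A (ρ i, s) * c⁻¹ := by
  have f1 : ∀ (k : GT A ≃* GT A) i, ∃ c a s j, 1 ≤ j ∧ j ≤ 3 ∧
      k (gen A i) = c * lt A (a, s) ^ j * c⁻¹ := by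
    intro k i
    obtain ⟨c, a, s, j, hj, h1⟩ := F1 hA (k (gen A i)) (by rw [← map_pow, gen_pow, map_one])
    refine ⟨c, a, s, j, ?_, hj, h1⟩
    by_contra h0
    obtain rfl : j = 0 := by omega
    apply gen_ne_one hA i
    apply k.injective
    rw [h1]; simp
  choose C a S J hJ1 hJ hh using f1 h
  have pairs : ∀ i k, i ≠ k → ∃ m, ((h (gen A i)) * h (gen A k)) ^ (m + 1) = 1 := by
    intro i k hik
    rcases lt_mul_pow' hA true hik with h' | h'
    · exact ⟨10, by rw [← map_mul, ← map_pow]; exact (congrArg h h').trans (map_one h)⟩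
    · exact ⟨12, by rw [← map_mul, ← map_pow]; exact (congrArg h h').trans (map_one h)⟩
  have f2 : ∀ i k, i ≠ k → (∃ p q : ℤ, (C i)⁻¹ * C k = gen A (a i) ^ p * gen A (a k) ^ q) ∧
      (a i ≠ a k → J i = 1 ∧ J k = 1 ∧ S i = S k) := by
    intro i k hik
    obtain ⟨m, hm⟩ := pairs i k hik
    apply F2 hA (hJ i) (hJ k) (hJ1 i) (hJ1 k) ((C i)⁻¹ * C k) m
    rw [hh i, hh k] at hm
    have e : C i * lt A (a i, S i) ^ J i * (C i)⁻¹ * (C k * lt A (a k, S k) ^ J k * (C k)⁻¹) =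
        C i * (lt A (a i, S i) ^ J i * ((C i)⁻¹ * C k) * lt A (a k, S k) ^ J k *
          ((C i)⁻¹ * C k)⁻¹) * (C i)⁻¹ := by group
    rw [e, conj_pow] at hm
    exact conj_eq_one_iff.1 hm
  have inj : ∀ i k, i ≠ k → a i ≠ a k := by
    intro i k hik haa
    obtain ⟨p, q, hpq⟩ := (f2 i k hik).1
    rw [← haa, ← zpow_add] at hpq
    apply not_comm hA hik
    apply h.injective
    rw [map_mul, map_mul, hh i, hh k, ← haa]
    have e : C k = C i * gen A (a i) ^ (p + q) := by rw [← hpq]; group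
    obtain ⟨x, hx⟩ := lt_zpow (A := A) (a i) (S i)
    obtain ⟨y, hy⟩ := lt_zpow (A := A) (a i) (S k)
    rw [e, hx, hy]
    simp only [← zpow_natCast, ← zpow_mul]
    have e2 : ∀ t : ℤ, C i * gen A (a i) ^ (p + q) * gen A (a i) ^ t *
      (C i * gen A (a i) ^ (p + q))⁻¹ = C i * gen A (a i) ^ t * (C i)⁻¹ := by
      intro t; group
    rw [e2]
    have e3 : ∀ t u : ℤ, C i * gen A (a i) ^ t * (C i)⁻¹ * (C i * gen A (a i) ^ u * (C i)⁻¹) =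
        C i * gen A (a i) ^ (t + u) * (C i)⁻¹ := by
      intro t u; rw [zpow_add]; group
    rw [e3, e3, add_comm]
  have hJ' : ∀ i, J i = 1 := fun i =>
    ((f2 i (i + 1) (by omega)).2 (inj _ _ (by omega))).1
  have hS : ∀ i, S i = S 0 := by
    intro i
    by_cases hi : i = 0
    · rw [hi]
    · exact ((f2 i 0 hi).2 (inj _ _ hi)).2.2
  have hh' : ∀ i, h (gen A i) = C i * lt A (a i, S 0) * (C i)⁻¹ := by
    intro i; rw [hh i, hJ' i, hS i, pow_one]
  obtain ⟨p, q, h01⟩ := (f2 0 1 (by omega)).1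
  set c := C 0 * gen A (a 0) ^ p with hc
  have hc1 : c = C 1 * (gen A (a 1) ^ q)⁻¹ := by
    have : C 1 = C 0 * (gen A (a 0) ^ p * gen A (a 1) ^ q) := by rw [← h01]; group
    rw [this, hc]; group
  have fin : ∀ i, h (gen A i) = c * lt A (a i, S 0) * c⁻¹ := by
    intro i
    rw [hh' i]
    rcases Nat.lt_or_ge i 2 with hi | hi
    · interval_cases i
      · conv_lhs => rw [← gen_zpow_comm (A := A) (a 0) (S 0) p]
        rw [hc]; group
      · conv_lhs => rw [← gen_zpow_comm (A := A) (a 1) (S 0) (-q)]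
        rw [hc1]; group
    · obtain ⟨p', q', h0⟩ := (f2 0 i (by omega)).1
      obtain ⟨r', t', h1⟩ := (f2 1 i (by omega)).1
      have e0 : C i = c * (gen A (a 0) ^ (p' - p) * gen A (a i) ^ q') := by
        have : C i = C 0 * (gen A (a 0) ^ p' * gen A (a i) ^ q') := by rw [← h0]; group
        rw [this, hc]; group
      have e1 : C i = c * (gen A (a 1) ^ (q + r') * gen A (a i) ^ t') := by
        have : C i = C 1 * (gen A (a 1) ^ r' * gen A (a i) ^ t') := by rw [← h1]; group
        rw [this, hc1]; group
      have e2 := mul_left_cancel (e0.symm.trans e1)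
      have e3 : gen A (a 0) ^ (p' - p) * gen A (a i) ^ (q' - t') = gen A (a 1) ^ (q + r') := by
        rw [zpow_sub (gen A (a i)), ← mul_assoc, e2]; group
      have e4 := F3 hA (inj 0 1 (by omega)) (inj 0 i (by omega)) e3
      rw [(gen_zpow_eq_one hA _ _).2 e4, one_mul] at e0
      rw [e0]
      conv_rhs => rw [← gen_zpow_comm (A := A) (a i) (S 0) q']
      group
  have surj : Function.Surjective a := by
    intro b
    obtain ⟨d, i, t, j, hj1, hj, hd⟩ := f1 h.symm b
    refine ⟨i, ?_⟩
    obtain ⟨t', ht'⟩ : ∃ t', h (lt A (i, t)) = c * lt A (a i, t') * c⁻¹ := by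
      cases t
      · refine ⟨!(S 0), ?_⟩
        have : lt A (a i, !(S 0)) = (lt A (a i, S 0))⁻¹ := lt_il (a i, S 0)
        rw [this]
        simp only [lt, cond_false, map_inv]
        rw [fin i]; simp only [lt]; group
      · exact ⟨S 0, fin i⟩
    have hb : gen A b = (h d * c) * lt A (a i, t') ^ j * (h d * c)⁻¹ := by
      have := congrArg h hd
      rw [MulEquiv.apply_symm_apply, map_mul, map_mul, map_pow, ht', map_inv, conj_pow] at this
      rw [this]; group
    by_contra hne
    have hF := F2 hA (a := b) (b := a i) (s := false) (s' := t') (j := 1) (l := j) (by omega) hj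
      le_rfl hj1 (h d * c) 0 (by
        rw [pow_one, pow_one]
        simp only [lt, cond_false]
        rw [mul_assoc, mul_assoc, ← mul_assoc (h d * c)]
        simp only [lt] at hb
        rw [← hb, inv_mul_cancel])
    obtain ⟨-, rfl, ht⟩ := hF.2 (Ne.symm hne)
    obtain ⟨x, y, hxy⟩ := hF.1
    rw [hxy, pow_one] at hb
    have e1 : gen A b = gen A b ^ x * (gen A (a i) ^ y * lt A (a i, t') * (gen A (a i) ^ y)⁻¹) *
        (gen A b ^ x)⁻¹ := by
      conv_lhs => rw [hb]
      group
    rw [gen_zpow_comm] at e1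
    have e2 : lt A (a i, t') = gen A b := by
      have e3 := gen_zpow_comm (A := A) b true (-x)
      change gen A b ^ (-x) * gen A b * (gen A b ^ (-x))⁻¹ = gen A b at e3
      have e4 : lt A (a i, t') = gen A b ^ (-x) *
          (gen A b ^ x * lt A (a i, t') * (gen A b ^ x)⁻¹) * (gen A b ^ (-x))⁻¹ := by group
      rw [e4, ← e1]; exact e3
    apply pair_ne_one hA hne t' false
    rw [e2]; simp [lt]
  refine ⟨c, S 0, Equiv.ofBijective a ⟨fun i k hik => by_contra fun hne => inj i k hne hik, surj⟩,
    ?_, fin⟩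
  intro i k
  show A i k ↔ A (a i) (a k)
  by_cases hik : i = k
  · subst hik
    exact ⟨fun h => absurd h (hA.irrefl _), fun h => absurd h (hA.irrefl _)⟩
  · rw [adj_iff hA true hik, adj_iff hA (S 0) (inj i k hik)]
    have e : h (lt A (i, true) * lt A (k, true)) =
        c * (lt A (a i, S 0) * lt A (a k, S 0)) * c⁻¹ := by
      rw [map_mul]
      change h (gen A i) * h (gen A k) = _
      rw [fin i, fin k]; group
    rw [← map_eq_one_iff h h.injective, map_pow, e, conj_pow, conj_eq_one_iff]

/-- signed relabelling of letters -/
def trl (f : ℕ → ℕ) (s : Bool) (x : L) : L := (f x.1, if s then x.2 else !x.2)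

theorem lt_trl (k : GT A →* GT A) (f : ℕ → ℕ) (s : Bool) (hk : ∀ i, k (gen A i) = lt A (f i, s))
    (x : L) : k (lt A x) = lt A (trl f s x) := by
  obtain ⟨i, t⟩ := x
  cases t
  · simp only [lt, cond_false, map_inv, trl]
    rw [hk]; cases s <;> simp [lt]
  · simp only [lt, cond_true, trl]
    rw [hk]; cases s <;> simp [lt]

theorem exists_hom (hA : IsG A) (ρ : ℕ ≃ ℕ) (hρ : ∀ i j, A i j ↔ A (ρ i) (ρ j)) (s : Bool) :
    ∃ k : GT A →* GT A, ∀ i, k (gen A i) = lt A (ρ i, s) := by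
  refine ⟨PresentedGroup.toGroup (f := fun i => lt A (ρ i, s)) ?_, fun i =>
    PresentedGroup.toGroup.of _⟩
  rintro r (⟨i, rfl⟩ | ⟨i, j, h, rfl⟩ | ⟨i, j, hij, h, rfl⟩)
  · simpa using lt_pow (A := A) (ρ i) s
  · have hij : i ≠ j := by rintro rfl; exact hA.irrefl _ h
    simpa using lt_mul_pow hA (s := s) (ρ.injective.ne hij) (k := 11) (nn_adj hA ((hρ i j).1 h))
  · simpa using lt_mul_pow hA (s := s) (ρ.injective.ne hij) (k := 13)
      (nn_nadj (ρ.injective.ne hij) (fun hh => h ((hρ i j).2 hh)))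

theorem converse_thm (hA : IsG A) (ρ : ℕ ≃ ℕ) (hρ : ∀ i j, A i j ↔ A (ρ i) (ρ j)) (s : Bool)
    (c : GT A) : ∃ h : GT A ≃* GT A, ∀ i, h (gen A i) = c * lt A (ρ i, s) * c⁻¹ := by
  obtain ⟨k, hk⟩ := exists_hom hA ρ hρ s
  obtain ⟨k', hk'⟩ := exists_hom hA ρ.symm (fun i j => by
    rw [hρ (ρ.symm i) (ρ.symm j)]; simp) s
  have e1 : k'.comp k = MonoidHom.id _ := by
    apply PresentedGroup.ext
    intro i
    show k' (k (gen A i)) = gen A i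
    rw [hk, lt_trl k' _ s hk']
    cases s <;> simp [trl, lt]
  have e2 : k.comp k' = MonoidHom.id _ := by
    apply PresentedGroup.ext
    intro i
    show k (k' (gen A i)) = gen A i
    rw [hk', lt_trl k _ s hk]
    cases s <;> simp [trl, lt]
  refine ⟨(MonoidHom.toMulEquiv k k' e1 e2).trans (MulAut.conj c), fun i => ?_⟩
  show MulAut.conj c (k (gen A i)) = _
  rw [hk]; rfl

theorem hom_ev (h : GT A ≃* GT A) (c : GT A) (f : ℕ → ℕ) (s : Bool)
    (hh : ∀ i, h (gen A i) = c * lt A (f i, s) * c⁻¹) (w : List L) :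
    h (ev A w) = c * ev A (w.map (trl f s)) * c⁻¹ := by
  have hl := lt_trl (((MulAut.conj c⁻¹).toMonoidHom).comp h.toMonoidHom) f s (by
    intro i
    show c⁻¹ * h (gen A i) * c⁻¹⁻¹ = _
    rw [hh]; group)
  induction w with
  | nil => simp [ev_nil]
  | cons x w ih =>
    rw [ev_cons, map_mul, ih, List.map_cons, ev_cons, ← hl]
    show _ = c * (c⁻¹ * h (lt A x) * c⁻¹⁻¹ * _) * c⁻¹
    group

end WG

namespace WG

/-- The adjacency relation of a coded graph. -/
abbrev adjT (T : XGr) : ℕ → ℕ → Prop := fun m n => T.1 (m, n) = true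

theorem isG_adjT (T : XGr) : IsG (adjT T) where
  symm := fun i j h => by
    show T.1 (j, i) = true
    rw [T.2.1]; exact h
  irrefl := fun i h => by
    have := T.2.2 i
    rw [show T.1 (i, i) = true from h] at this
    exact Bool.noConfusion this

/-- The code of a letter. -/
def letc (x : L) : ℕ := cond x.2 (3 * x.1 + 1) (3 * x.1 + 2)

/-- Evaluation of a word in a binary operation on `ℕ`. -/
def evs (f : ℕ → ℕ → ℕ) : List L → ℕ
  | [] => 0
  | x :: w => f (letc x) (evs f w)

theorem code_lt {A : ℕ → ℕ → Prop} (c : CodingBijection A) (x : L) :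
    c.toEquiv (lt A x) = letc x := by
  rcases x with ⟨i, _ | _⟩
  · exact c.map_gen_inv i
  · exact c.map_gen i

theorem star_map {A : ℕ → ℕ → Prop} (c : CodingBijection A) (g h : GT A) :
    c.star (c.toEquiv g) (c.toEquiv h) = c.toEquiv (g * h) := by
  simp [CodingBijection.star]

theorem evs_eq {A : ℕ → ℕ → Prop} (c : CodingBijection A) (w : List L) :
    evs c.star w = c.toEquiv (ev A w) := by
  induction w with
  | nil => simp [evs, ev_nil, c.map_one]
  | cons x w ih => rw [evs, ih, ← code_lt c, star_map, ev_cons]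

theorem meas_comp {X : Type*} [MeasurableSpace X] {f : X → ℕ → ℕ} (hf : ∀ n, Measurable fun x => f x n)
    {g : X → ℕ} (hg : Measurable g) : Measurable fun x => f x (g x) := by
  have h2 : Measurable (fun p : X × ℕ => f p.1 p.2) := measurable_from_prod_countable_left hf
  exact h2.comp (measurable_id.prodMk hg)

theorem meas_evs {X : Type*} [MeasurableSpace X] {f : X → ℕ → ℕ → ℕ}
    (hf : ∀ n m, Measurable fun x => f x n m) (w : List L) : Measurable fun x => evs (f x) w := by
  induction w with
  | nil => exact measurable_const
  | cons x w ih => exact meas_comp (hf (letc x)) ih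

/-- The words used for a given pair of data. -/
def tr (t : List ℕ) (s : Bool) (w : List L) : List L := w.map (trl (fun i => t.getD i 0) s)

/-- One piece of the countable decomposition. -/
def cond1 (f : ℕ → ℕ → ℕ) (s : List ℕ) (c : ℕ) (b : Bool) (W : List (List L)) (t : List ℕ) : Prop :=
  ∀ n, n < s.length → (evs f (W.getD n []) = n ∧
    f c (evs f (tr t b (W.getD n []))) = f (s.getD n 0) c)

/-- All labels of the words are within the domain of `t`. -/
def dom1 (W : List (List L)) (t : List ℕ) : Prop := ∀ w ∈ W, ∀ x ∈ w, x.1 < t.length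

theorem meas_cond1 {X : Type*} [MeasurableSpace X] {f : X → ℕ → ℕ → ℕ}
    (hf : ∀ n m, Measurable fun x => f x n m) (s : List ℕ) (c : ℕ) (b : Bool)
    (W : List (List L)) (t : List ℕ) : MeasurableSet {x | cond1 (f x) s c b W t} := by
  unfold cond1
  simp only [Set.setOf_forall]
  refine MeasurableSet.iInter fun n => MeasurableSet.iInter fun _ => ?_
  refine MeasurableSet.inter ?_ ?_
  · exact measurableSet_eq_fun (meas_evs hf _) measurable_const
  · exact measurableSet_eq_fun (meas_comp (hf c) (meas_evs hf _)) (hf _ _)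

theorem tr_congr {W : List (List L)} {t : List ℕ} (hd : dom1 W t) (ρ : ℕ → ℕ)
    (hρ : ∀ (n : ℕ) (hn : n < t.length), ρ n = t.get ⟨n, hn⟩) (b : Bool) (n : ℕ) :
    tr t b (W.getD n []) = (W.getD n []).map (trl ρ b) := by
  apply List.map_congr_left
  intro x hx
  have hx1 : x.1 < t.length := by
    by_cases hn : n < W.length
    · rw [List.getD_eq_getElem _ _ hn] at hx
      exact hd _ (List.getElem_mem hn) x hx
    · rw [List.getD_eq_default _ _ (by omega)] at hx
      simp at hx
  have := hρ x.1 hx1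
  simp only [trl]
  rw [this, List.getD_eq_getElem _ _ hx1]; rfl

theorem exists_bound (W : List (List L)) : ∃ M : ℕ, ∀ w ∈ W, ∀ x ∈ w, x.1 < M := by
  refine ⟨(W.flatten.map Prod.fst).sum + 1, fun w hw x hx => ?_⟩
  have : x.1 ∈ W.flatten.map Prod.fst :=
    List.mem_map_of_mem (List.mem_flatten.2 ⟨w, hw, hx⟩)
  have := List.le_sum_of_mem this
  omega

theorem aut_forward {A : ℕ → ℕ → Prop} (hA : IsG A) (φ : CodingBijection A) (s : List ℕ)
    (h : ℕ → ℕ) (hb : Function.Bijective h)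
    (hm : ∀ n m, h (φ.star n m) = φ.star (h n) (h m))
    (hs : ∀ (n : ℕ) (hn : n < s.length), h n = s.get ⟨n, hn⟩) :
    ∃ (c : ℕ) (b : Bool) (W : List (List L)) (t : List ℕ), t.Nodup ∧ dom1 W t ∧
      (∃ ρ : ℕ ≃ ℕ, (∀ m n, A m n ↔ A (ρ m) (ρ n)) ∧
        ∀ (n : ℕ) (hn : n < t.length), ρ n = t.get ⟨n, hn⟩) ∧ cond1 φ.star s c b W t := by
  let k : GT A ≃* GT A :=
    { (φ.toEquiv.trans (Equiv.ofBijective h hb)).trans φ.toEquiv.symm with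
      map_mul' := by
        intro x y
        show φ.toEquiv.symm (h (φ.toEquiv (x * y))) =
          φ.toEquiv.symm (h (φ.toEquiv x)) * φ.toEquiv.symm (h (φ.toEquiv y))
        rw [← star_map, hm]
        simp [CodingBijection.star] }
  have hk : ∀ x, φ.toEquiv (k x) = h (φ.toEquiv x) := fun x => by
    show φ.toEquiv (φ.toEquiv.symm (h (φ.toEquiv x))) = _
    simp
  obtain ⟨c, b, ρ, hρ, hc⟩ := structure_thm hA k
  have hw : ∀ n : ℕ, ∃ w, ev A w = φ.toEquiv.symm n := fun n => exists_word _
  choose w hw using hw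
  set W := (List.range s.length).map w with hW
  obtain ⟨M, hM⟩ := exists_bound W
  have hdom : dom1 W ((List.range M).map ρ) := by
    intro u hu x hx
    simpa using hM u hu x hx
  have hext : ∀ (n : ℕ) (hn : n < ((List.range M).map ρ).length),
      ρ n = ((List.range M).map ρ).get ⟨n, hn⟩ := by
    intro n hn; simp
  refine ⟨φ.toEquiv c, b, W, (List.range M).map ρ, List.nodup_range.map ρ.injective, hdom,
    ⟨ρ, hρ, hext⟩, ?_⟩
  intro n hn
  have hWn : W.getD n [] = w n := by
    rw [List.getD_eq_getElem _ _ (by simpa [hW] using hn)]; simp [hW]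
  rw [tr_congr hdom ρ hext, hWn, evs_eq, evs_eq, hw, List.getD_eq_getElem _ _ hn]
  refine ⟨by simp, ?_⟩
  have h1 := hom_ev k c ρ b hc (w n)
  have h2 := hs n hn
  have h3 := hk (φ.toEquiv.symm n)
  rw [Equiv.apply_symm_apply, h2] at h3
  change _ = s[n] at h3
  rw [← h3, star_map, star_map, ← hw, h1]
  congr 1; group

theorem aut_backward {A : ℕ → ℕ → Prop} (hA : IsG A) (φ : CodingBijection A) (s : List ℕ)
    (c : ℕ) (b : Bool) (W : List (List L)) (t : List ℕ) (hd : dom1 W t)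
    (ρ : ℕ ≃ ℕ) (hρ : ∀ m n, A m n ↔ A (ρ m) (ρ n))
    (hext : ∀ (n : ℕ) (hn : n < t.length), ρ n = t.get ⟨n, hn⟩)
    (hc : cond1 φ.star s c b W t) :
    ∃ h : ℕ → ℕ, Function.Bijective h ∧ (∀ n m, h (φ.star n m) = φ.star (h n) (h m)) ∧
      ∀ (n : ℕ) (hn : n < s.length), h n = s.get ⟨n, hn⟩ := by
  obtain ⟨k, hk⟩ := converse_thm hA ρ hρ b (φ.toEquiv.symm c)
  refine ⟨fun n => φ.toEquiv (k (φ.toEquiv.symm n)), ?_, ?_, ?_⟩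
  · exact ((φ.toEquiv.symm.trans k.toEquiv).trans φ.toEquiv).bijective
  · intro n m
    simp [CodingBijection.star]
  · intro n hn
    obtain ⟨h1, h2⟩ := hc n hn
    rw [tr_congr hd ρ hext, List.getD_eq_getElem _ _ hn, evs_eq] at h2
    rw [evs_eq] at h1
    have h3 : φ.toEquiv.symm n = ev A (W.getD n []) := by
      rw [Equiv.symm_apply_eq]; exact h1.symm
    show φ.toEquiv (k (φ.toEquiv.symm n)) = s[n]
    rw [h3, hom_ev k _ ρ b hk]
    have h4 := φ.toEquiv.injective h2
    rw [Equiv.symm_apply_apply] at h4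
    rw [h4]; simp

end WG

/-- **Corollary 3.9.** Assume each graph `T ∈ X_Gr` is given a coding bijection for `G_T`
in such a way that `T ↦ ⋆_T` is Borel, and let `B ⊆ X_Gr` be Borel. If for every injective
finite sequence `s` the set of `T ∈ B` such that some graph automorphism of `T` extends
`s` is Borel, then for every injective finite sequence `s` the set of `T ∈ B` such that
some group automorphism of `(ℕ, ⋆_T)` extends `s` is Borel. -/
theorem Sigma_borel_of_sigma_borel
    (code : ∀ T : XGr, CodingBijection (fun m n => T.1 (m, n) = true))
    (hcode : Measurable fun T : XGr => fun p : ℕ × ℕ => (code T).star p.1 p.2)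
    (B : Set XGr) (hB : MeasurableSet B)
    (hσ : ∀ s : List ℕ, s.Nodup →
      MeasurableSet {T : XGr | T ∈ B ∧ ∃ ρ : ℕ ≃ ℕ,
        (∀ m n, T.1 (m, n) = true ↔ T.1 (ρ m, ρ n) = true) ∧
        ∀ (n : ℕ) (hn : n < s.length), ρ n = s.get ⟨n, hn⟩}) :
    ∀ s : List ℕ, s.Nodup →
      MeasurableSet {T : XGr | T ∈ B ∧ ∃ h : ℕ → ℕ, Function.Bijective h ∧
        (∀ n m, h ((code T).star n m) = (code T).star (h n) (h m)) ∧
        ∀ (n : ℕ) (hn : n < s.length), h n = s.get ⟨n, hn⟩} := by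
  intro s _
  have hf : ∀ n m, Measurable fun T : XGr => (code T).star n m := fun n m =>
    (measurable_pi_apply (n, m)).comp hcode
  have key : {T : XGr | T ∈ B ∧ ∃ h : ℕ → ℕ, Function.Bijective h ∧
        (∀ n m, h ((code T).star n m) = (code T).star (h n) (h m)) ∧
        ∀ (n : ℕ) (hn : n < s.length), h n = s.get ⟨n, hn⟩} =
      ⋃ (c : ℕ) (b : Bool) (W : List (List WG.L)) (t : List ℕ) (_ : t.Nodup) (_ : WG.dom1 W t),
        ({T : XGr | T ∈ B ∧ ∃ ρ : ℕ ≃ ℕ,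
          (∀ m n, T.1 (m, n) = true ↔ T.1 (ρ m, ρ n) = true) ∧
          ∀ (n : ℕ) (hn : n < t.length), ρ n = t.get ⟨n, hn⟩} ∩
        {T : XGr | WG.cond1 (code T).star s c b W t}) := by
    ext T
    simp only [Set.mem_iUnion, Set.mem_inter_iff, Set.mem_setOf_eq]
    constructor
    · rintro ⟨hT, h, hb, hm, hs⟩
      obtain ⟨c, b, W, t, ht, hd, hρ, hc⟩ :=
        WG.aut_forward (WG.isG_adjT T) (code T) s h hb hm hs
      exact ⟨c, b, W, t, ht, hd, ⟨hT, hρ⟩, hc⟩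
    · rintro ⟨c, b, W, t, ht, hd, ⟨hT, ρ, hρ, hext⟩, hc⟩
      exact ⟨hT, WG.aut_backward (WG.isG_adjT T) (code T) s c b W t hd ρ hρ hext hc⟩
  rw [key]
  refine MeasurableSet.iUnion fun c => MeasurableSet.iUnion fun b => MeasurableSet.iUnion fun W =>
    MeasurableSet.iUnion fun t => MeasurableSet.iUnion fun ht => MeasurableSet.iUnion fun _ => ?_
  exact (hσ t ht).inter (WG.meas_cond1 hf s c b W t)
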